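/- arXiv:1803.03928 — 3 statements merged into one kernel-verified Lean document; each statement's English description precedes it below -/
import Mathlib

section
/- Let 𝕜 be an algebraically closed field of characteristic 0 and A = diag(λ₁,…,λ_k) a diagonal invertible matrix with multiplicatively independent eigenvalues. Then every infinite subset of the orbit {A^n·(1,…,1) : n ∈ ℕ₀} is Zariski dense in affine k-space; that is, if a nonzero polynomial F ∈ 𝕜[x₁,…,x_k] satisfies F(λ₁^n,…,λ_k^n) = 0, this holds for at most finitely many n. -/
open Polynomial

theorem sml_core {S : Type*} [CommRing S] [IsDomain S] [CharZero S] (p : ℕ) (hp : p.Prime)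
    (hsep : ∀ y : S, (∀ N, (p : S) ^ N ∣ y) → y = 0) (f : ℕ → S)
    (hf : ∀ N : ℕ, ∃ Q : S[X], (∀ k, (p : S) ^ k ∣ Q.coeff k) ∧
      ∀ n : ℕ, (p : S) ^ N ∣ f n - Q.eval (n : S))
    (hinf : {n | f n = 0}.Infinite) : ∀ n, f n = 0 := by
  have hp0 : (p : S) ≠ 0 := by exact_mod_cast hp.ne_zero
  have key : ∀ r : ℕ, ∃ T : Finset ℕ, ∀ N : ℕ, ∃ Q : S[X],
      (∀ k, (p : S) ^ (k + r) ∣ Q.coeff k) ∧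
      ∀ n : ℕ, (p : S) ^ N ∣ f n - (∏ j ∈ T, ((n : S) - (j : S))) * Q.eval (n : S) := by
    intro r
    induction r with
    | zero =>
      refine ⟨∅, fun N => ?_⟩
      simpa using hf N
    | succ r ih =>
      obtain ⟨T, hT⟩ := ih
      obtain ⟨m, hm, hmT⟩ := hinf.exists_notMem_finset T
      refine ⟨insert m T, fun N => ?_⟩
      set D : ℤ := ∏ j ∈ T, ((m : ℤ) - (j : ℤ)) with hD
      have hD0 : D ≠ 0 := by
        rw [hD, Finset.prod_ne_zero_iff]
        intro j hj h
        have : m = j := by omega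
        exact hmT (this ▸ hj)
      have hfin : FiniteMultiplicity (p : ℤ) D :=
        Int.finiteMultiplicity_iff.2 ⟨by simpa using hp.ne_one, hD0⟩
      obtain ⟨u, hu, hpu⟩ := hfin.exists_eq_pow_mul_and_not_dvd
      set v := multiplicity (p : ℤ) D
      have hcop : IsCoprime (p : ℤ) u :=
        (Prime.coprime_iff_not_dvd (Nat.prime_iff_prime_int.1 hp)).2 hpu
      have hcopS : IsCoprime ((p : S) ^ N) (u : S) := by
        have := hcop.map (Int.castRingHom S)
        simp only [eq_intCast, Int.cast_natCast] at this
        exact this.pow_left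
      obtain ⟨Q, hQ, hfQ⟩ := hT (N + v)
      have hQm : (p : S) ^ N ∣ Q.eval (m : S) := by
        have h1 := hfQ m
        have hm' : f m = 0 := hm
        have h2 : (∏ j ∈ T, ((m : S) - (j : S))) = (p : S) ^ v * (u : S) := by
          have := congrArg (Int.cast : ℤ → S) (hD.symm.trans hu)
          push_cast at this
          exact this
        rw [hm', zero_sub, dvd_neg, h2, pow_add, mul_comm ((p : S) ^ N), mul_assoc] at h1
        have h3 := (mul_dvd_mul_iff_left (pow_ne_zero v hp0)).1 h1
        exact hcopS.dvd_of_dvd_mul_left h3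
      refine ⟨Q /ₘ (X - C (m : S)), fun k => ?_, fun n => ?_⟩
      · rw [coeff_divByMonic_X_sub_C]
        refine Finset.dvd_sum fun i hi => Dvd.dvd.mul_left ?_ _
        refine (pow_dvd_pow _ ?_).trans (hQ i)
        have := (Finset.mem_Icc.1 hi).1
        omega
      · have h1 := X_sub_C_mul_divByMonic_eq_sub_modByMonic Q (m : S)
        rw [modByMonic_X_sub_C_eq_C_eval] at h1
        have h2 := congrArg (Polynomial.eval (n : S)) h1
        simp only [eval_mul, eval_sub, eval_X, eval_C] at h2
        rw [Finset.prod_insert hmT]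
        have h3 : f n - ((n : S) - m) * (∏ j ∈ T, ((n : S) - (j : S))) *
            (Q /ₘ (X - C (m : S))).eval (n : S) =
            (f n - (∏ j ∈ T, ((n : S) - (j : S))) * Q.eval (n : S)) +
            (∏ j ∈ T, ((n : S) - (j : S))) * Q.eval (m : S) := by
          linear_combination (-(∏ j ∈ T, ((n : S) - (j : S)))) * h2
        rw [h3]
        exact dvd_add ((pow_dvd_pow _ (by omega)).trans (hfQ n)) (hQm.mul_left _)
  intro n
  refine hsep _ fun N => ?_
  obtain ⟨T, hT⟩ := key N
  obtain ⟨Q, hQ, hfQ⟩ := hT N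
  have h1 : (p : S) ^ N ∣ Q.eval (n : S) := by
    rw [eval_eq_sum_range]
    exact Finset.dvd_sum fun i _ => ((pow_dvd_pow _ (by omega)).trans (hQ i)).mul_right _
  have := dvd_add (hfQ n) (h1.mul_left (∏ j ∈ T, ((n : S) - (j : S))))
  simpa using this

theorem sml_factorial (p : ℕ) (hp : p.Prime) (k : ℕ) : ∃ w u : ℕ, p ^ k = w * p ^ (padicValNat p k.factorial) ∧
    k.factorial = p ^ (padicValNat p k.factorial) * u ∧ p.Coprime u := by
  have := Fact.mk hp
  have hle : padicValNat p k.factorial ≤ k := by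
    rcases eq_or_ne k 0 with rfl | hk
    · simp
    · have := sub_one_mul_padicValNat_factorial_lt_of_ne_zero p hk
      have h2 := hp.two_le
      have : 1 * padicValNat p k.factorial ≤ (p - 1) * padicValNat p k.factorial :=
        Nat.mul_le_mul_right _ (by omega)
      omega
  obtain ⟨u, hu⟩ := (pow_padicValNat_dvd : p ^ padicValNat p k.factorial ∣ k.factorial)
  refine ⟨p ^ (k - padicValNat p k.factorial), u, ?_, hu, ?_⟩
  · rw [← pow_add]; congr 1; omega
  · rw [hp.coprime_iff_not_dvd]
    rintro ⟨c, rfl⟩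
    apply pow_succ_padicValNat_not_dvd (p := p) (Nat.factorial_ne_zero k)
    exact ⟨c, by rw [hu.trans (by ring : _ = p ^ (padicValNat p k.factorial + 1) * c)]; congr 2; rw [← hu.trans (by ring : _ = p ^ (padicValNat p k.factorial + 1) * c)]⟩

theorem sml_one {S : Type*} [CommRing S] (p : ℕ) (hp : p.Prime) (a : S) (N : ℕ) :
    ∃ Q : S[X], (∀ k, (p : S) ^ k ∣ Q.coeff k) ∧
      ∀ n : ℕ, (p : S) ^ N ∣ (1 + (p : S) ^ 2 * a) ^ n - Q.eval (n : S) := by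
  have hk : ∀ k : ℕ, ∃ Q : S[X], (∀ j, (p : S) ^ j ∣ Q.coeff j) ∧
      ∀ n : ℕ, (p : S) ^ N ∣ ((p : S) ^ 2 * a) ^ k * (n.choose k : S) - Q.eval (n : S) := by
    intro k
    obtain ⟨w, u, hw, hu, hpu⟩ := sml_factorial p hp k
    set v := padicValNat p k.factorial
    have hc : IsCoprime ((p : S) ^ N) (u : S) := by
      have := (Nat.isCoprime_iff_coprime.2 hpu).map (Int.castRingHom S)
      simp only [eq_intCast, Int.cast_natCast] at this
      exact this.pow_left
    obtain ⟨x, y, hxy⟩ := hc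
    refine ⟨C ((p : S) ^ k * (w * y * a ^ k)) * descPochhammer S k, fun j => ?_, fun n => ?_⟩
    · rw [coeff_C_mul]
      rcases le_or_gt j k with h | h
      · exact (((pow_dvd_pow _ h).mul_right _)).mul_right _
      · rw [coeff_eq_zero_of_natDegree_lt]
        · simp
        · refine lt_of_le_of_lt ?_ h
          rw [← descPochhammer_map (Int.castRingHom S)]
          refine natDegree_map_le.trans ?_
          rw [descPochhammer_natDegree]
    · rw [eval_mul, eval_C, descPochhammer_eval_eq_descFactorial,
        Nat.descFactorial_eq_factorial_mul_choose, hu]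
      have hw' : (p : S) ^ k = w * (p : S) ^ v := by exact_mod_cast congrArg (Nat.cast : ℕ → S) hw
      refine ⟨x * (p : S) ^ k * (p : S) ^ k * a ^ k * (n.choose k : S), ?_⟩
      push_cast
      rw [mul_pow, ← pow_mul, two_mul, pow_add]
      linear_combination (-(p : S) ^ k * (p : S) ^ k * a ^ k * (n.choose k : S)) * hxy + ((p : S) ^ k * y * a ^ k * (n.choose k : S) * u) * hw'
  choose Q hQ hQ' using hk
  refine ⟨∑ k ∈ Finset.range N, Q k, fun j => ?_, fun n => ?_⟩
  · rw [finsetSum_coeff]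
    exact Finset.dvd_sum fun k _ => hQ k j
  · rw [eval_finsetSum]
    have h1 : (1 + (p : S) ^ 2 * a) ^ n =
        ∑ k ∈ Finset.range (N + n + 1), ((p : S) ^ 2 * a) ^ k * (n.choose k : S) := by
      rw [add_comm 1, add_pow]
      simp only [one_pow, mul_one]
      refine Finset.sum_subset (Finset.range_mono (by omega)) fun k _ hk => ?_
      rw [Nat.choose_eq_zero_of_lt (by simpa using hk)]
      simp
    rw [h1, add_assoc, Finset.sum_range_add, add_sub_right_comm, ← Finset.sum_sub_distrib]
    refine dvd_add (Finset.dvd_sum fun k _ => hQ' k n) (Finset.dvd_sum fun k _ => ?_)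
    refine Dvd.dvd.mul_right ?_ _
    rw [mul_pow, ← pow_mul]
    exact (pow_dvd_pow _ (by omega)).mul_right _

theorem sml_sum {S : Type*} [CommRing S] [IsDomain S] [CharZero S] (p : ℕ) (hp : p.Prime)
    (hsep : ∀ y : S, (∀ N, (p : S) ^ N ∣ y) → y = 0) {ι : Type*} (s : Finset ι) (c a : ι → S)
    (hinf : {n : ℕ | ∑ i ∈ s, c i * (1 + (p : S) ^ 2 * a i) ^ n = 0}.Infinite) :
    ∀ n : ℕ, ∑ i ∈ s, c i * (1 + (p : S) ^ 2 * a i) ^ n = 0 := by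
  refine sml_core p hp hsep _ (fun N => ?_) hinf
  choose Q hQ hQ' using fun i => sml_one p hp (a i) N
  refine ⟨∑ i ∈ s, C (c i) * Q i, fun k => ?_, fun n => ?_⟩
  · rw [finsetSum_coeff]
    refine Finset.dvd_sum fun i _ => ?_
    rw [coeff_C_mul]
    exact (hQ i k).mul_left _
  · rw [eval_finsetSum, ← Finset.sum_sub_distrib]
    refine Finset.dvd_sum fun i _ => ?_
    rw [eval_mul, eval_C, ← mul_sub]
    exact (hQ' i n).mul_left _

theorem sml_unit {Q : Type*} [CommRing Q] (p : ℕ) (hp0 : p ≠ 0) (hp : (p : Q) = 0) (ν : Q)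
    (hν : IsIntegral ℤ ν) (hu : IsUnit ν) : ∃ M : ℕ, 0 < M ∧ ν ^ M = 1 := by
  have hfg : Module.Finite ℤ (Algebra.adjoin ℤ {ν}) :=
    Module.Finite.iff_fg.2 hν.fg_adjoin_singleton
  have hfin : Finite (Algebra.adjoin ℤ {ν}) := by
    refine Module.finite_of_fg_torsion _ fun x => ?_
    refine ⟨⟨(p : ℤ), by simpa using hp0⟩, ?_⟩
    apply Subtype.ext
    change (p : ℤ) • (x : Q) = 0
    simp [hp]
  have hmem : ν ∈ Algebra.adjoin ℤ {ν} := Algebra.self_mem_adjoin_singleton ℤ ν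
  obtain ⟨a, b, hab, h⟩ := Finite.exists_ne_map_eq_of_infinite
    (fun n : ℕ => (⟨ν, hmem⟩ : Algebra.adjoin ℤ {ν}) ^ n)
  have h' : ν ^ a = ν ^ b := by simpa using congrArg Subtype.val h
  have aux : ∀ a b : ℕ, a < b → ν ^ a = ν ^ b → ∃ M : ℕ, 0 < M ∧ ν ^ M = 1 := by
    intro a b hab h
    refine ⟨b - a, by omega, ?_⟩
    apply (hu.pow a).mul_left_cancel
    rw [← pow_add, Nat.add_sub_cancel' hab.le, mul_one, h]
  rcases lt_or_gt_of_ne hab with h1 | h1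
  · exact aux a b h1 h'
  · exact aux b a h1 h'.symm

theorem sml_noether {K : Type*} [Field K] [CharZero K] (G : Finset K) :
    ∃ (s : ℕ) (t : Fin s → K) (N : ℕ), AlgebraicIndependent ℚ t ∧ N ≠ 0 ∧ ∀ x ∈ G,
      ((MvPolynomial.aeval t : MvPolynomial (Fin s) ℤ →ₐ[ℤ] K) :
        MvPolynomial (Fin s) ℤ →+* K).IsIntegralElem ((N : K) * x) := by
  classical
  let A := Algebra.adjoin ℚ (G : Set K)
  have hA : Algebra.FiniteType ℚ A :=
    (Subalgebra.fg_iff_finiteType _).1 (Subalgebra.fg_adjoin_finset G)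
  obtain ⟨s, g, hginj, hgfin⟩ := exists_finite_inj_algHom_of_fg ℚ A
  let φ : MvPolynomial (Fin s) ℚ →ₐ[ℚ] K := A.val.comp g
  let t : Fin s → K := fun i => φ (MvPolynomial.X i)
  have hφ : φ = MvPolynomial.aeval t := by
    apply MvPolynomial.algHom_ext
    intro i
    simp [t]
  have hφinj : Function.Injective φ := Subtype.val_injective.comp hginj
  let ψ : MvPolynomial (Fin s) ℤ →+* K :=
    ((MvPolynomial.aeval t : MvPolynomial (Fin s) ℤ →ₐ[ℤ] K) : MvPolynomial (Fin s) ℤ →+* K)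
  have hψ : ψ = (φ : MvPolynomial (Fin s) ℚ →+* K).comp (MvPolynomial.map (Int.castRingHom ℚ)) := by
    apply MvPolynomial.ringHom_ext
    · intro r; simp [ψ]
    · intro i; simp [ψ, t]
  have hx : ∀ x ∈ G, ∃ n : ℕ, n ≠ 0 ∧ ψ.IsIntegralElem ((n : K) * x) := by
    intro x hx
    have h1 : (φ : MvPolynomial (Fin s) ℚ →+* K).IsIntegralElem x := by
      obtain ⟨P, hP, hP'⟩ := hgfin.to_isIntegral ⟨x, Algebra.subset_adjoin hx⟩
      refine ⟨P, hP, ?_⟩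
      have := congrArg A.val hP'
      rw [map_zero] at this
      have h2 := Polynomial.hom_eval₂ P (g : MvPolynomial (Fin s) ℚ →+* A)
        (A.val : A →+* K) ⟨x, Algebra.subset_adjoin hx⟩
      exact h2.symm.trans this
    let : Algebra (MvPolynomial (Fin s) ℚ) K := (φ : MvPolynomial (Fin s) ℚ →+* K).toAlgebra
    let : Algebra (MvPolynomial (Fin s) ℤ) K := ψ.toAlgebra
    let : Algebra (MvPolynomial (Fin s) ℤ) (MvPolynomial (Fin s) ℚ) :=
      MvPolynomial.algebraMvPolynomial
    have : IsScalarTower (MvPolynomial (Fin s) ℤ) (MvPolynomial (Fin s) ℚ) K := by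
      apply IsScalarTower.of_algebraMap_eq'
      exact hψ
    have h2 : IsIntegral (MvPolynomial (Fin s) ℚ) x := h1
    obtain ⟨⟨m, z, hz, hzm⟩, hm⟩ := IsIntegral.exists_multiple_integral_of_isLocalization
      (Submonoid.map (MvPolynomial.C : ℤ →+* MvPolynomial (Fin s) ℤ) (nonZeroDivisors ℤ)) x h2
    have hz0 : z ≠ 0 := nonZeroDivisors.ne_zero hz
    have h3 : IsIntegral (MvPolynomial (Fin s) ℤ) ((z : K) * x) := by
      have hzx : (z : K) * x = m • x := by
        rw [Algebra.smul_def, ← hzm]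
        congr 1
        change _ = ψ _
        simp [ψ]
      rw [hzx]
      exact hm
    refine ⟨z.natAbs, by simpa using hz0, ?_⟩
    change IsIntegral (MvPolynomial (Fin s) ℤ) _
    rcases Int.natAbs_eq z with h | h
    · have : ((z.natAbs : ℕ) : K) = (z : K) := by
        conv_rhs => rw [h]
        simp
      rw [this]; exact h3
    · have : ((z.natAbs : ℕ) : K) = -(z : K) := by
        conv_rhs => rw [h]
        simp
      rw [this, neg_mul]; exact h3.neg
  choose! n hn0 hn using hx
  refine ⟨s, t, ∏ x ∈ G, n x, ?_, Finset.prod_ne_zero_iff.2 hn0, fun x hx => ?_⟩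
  · change Function.Injective (MvPolynomial.aeval t)
    rw [← hφ]; exact hφinj
  · rw [← Finset.mul_prod_erase G n hx]
    push_cast
    let : Algebra (MvPolynomial (Fin s) ℤ) K := ψ.toAlgebra
    have h1 : IsIntegral (MvPolynomial (Fin s) ℤ) ((n x : K) * x) := hn x hx
    have h2 : IsIntegral (MvPolynomial (Fin s) ℤ) ((∏ x ∈ G.erase x, (n x : K))) :=
      IsIntegral.prod _ fun y _ => by
        have := isIntegral_algebraMap (R := MvPolynomial (Fin s) ℤ) (A := K) (x := (n y : MvPolynomial (Fin s) ℤ))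
        simpa using this
    have h3 : IsIntegral (MvPolynomial (Fin s) ℤ) ((n x : K) * (∏ x ∈ G.erase x, (n x : K)) * x) := by
      rw [mul_right_comm]
      exact h1.mul h2
    exact h3

theorem sml_ring {K : Type*} [Field K] [CharZero K] (G : Finset K) :
    ∃ (p N : ℕ) (S : Subalgebra ℤ K), p.Prime ∧ N ≠ 0 ∧ IsNoetherianRing S ∧ ¬ IsUnit (p : S) ∧
      (∀ x ∈ G, (N : K) * x ∈ S) ∧
      ∀ x ∈ G, x ≠ 0 → x⁻¹ ∈ G → ∀ y : S, (y : K) = N * x →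
        ∃ M : ℕ, 0 < M ∧ (p : S) ∣ y ^ M - 1 := by
  classical
  obtain ⟨s, t, N, ht, hN, hG⟩ := sml_noether G
  obtain ⟨p, hpN, hp⟩ := Nat.exists_infinite_primes (N + 1)
  have hpcop : Nat.Coprime p N :=
    (Nat.Prime.coprime_iff_not_dvd hp).2 fun h =>
      absurd (Nat.le_of_dvd (Nat.pos_of_ne_zero hN) h) (by omega)
  have hpK : (p : K) ≠ 0 := by exact_mod_cast hp.ne_zero
  have hpQ : (p : ℚ) ≠ 0 := by exact_mod_cast hp.ne_zero
  let t' : Fin s → K := fun i => t i / p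
  let S : Subalgebra ℤ K :=
    Algebra.adjoin ℤ ((Finset.univ.image t' ∪ G.image (fun x => (N : K) * x) : Finset K) : Set K)
  have hSfin : Algebra.FiniteType ℤ S :=
    (Subalgebra.fg_iff_finiteType _).1 (Subalgebra.fg_adjoin_finset _)
  have ht'S : ∀ i, t' i ∈ S := fun i => Algebra.subset_adjoin (by simp)
  have hGS : ∀ x ∈ G, (N : K) * x ∈ S := fun x hx => Algebra.subset_adjoin (by
    simp only [Finset.coe_union, Finset.coe_image, Set.mem_union]
    exact Or.inr ⟨x, hx, rfl⟩)
  refine ⟨p, N, S, hp, hN, Algebra.FiniteType.isNoetherianRing ℤ S, ?_, hGS, ?_⟩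
  · intro hpunit
    obtain ⟨y, hay⟩ := hpunit.exists_right_inv
    let ψ : MvPolynomial (Fin s) ℤ →+* K :=
      ((MvPolynomial.aeval t' : MvPolynomial (Fin s) ℤ →ₐ[ℤ] K) : MvPolynomial (Fin s) ℤ →+* K)
    have hψinj : Function.Injective ψ := by
      let θ : MvPolynomial (Fin s) ℚ →ₐ[ℚ] MvPolynomial (Fin s) ℚ :=
        MvPolynomial.aeval fun i => MvPolynomial.C (p : ℚ)⁻¹ * MvPolynomial.X i
      let θ' : MvPolynomial (Fin s) ℚ →ₐ[ℚ] MvPolynomial (Fin s) ℚ :=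
        MvPolynomial.aeval fun i => MvPolynomial.C (p : ℚ) * MvPolynomial.X i
      have h1 : θ'.comp θ = AlgHom.id ℚ _ := by
        apply MvPolynomial.algHom_ext
        intro i
        simp only [θ, θ', AlgHom.comp_apply, MvPolynomial.aeval_X, map_mul, MvPolynomial.algHom_C,
          MvPolynomial.algebraMap_eq, AlgHom.id_apply]
        rw [← mul_assoc, ← MvPolynomial.C_mul, inv_mul_cancel₀ hpQ, MvPolynomial.C_1, one_mul]
      have h2 : Function.Injective θ := Function.LeftInverse.injective (g := θ')
        fun x => by simpa using DFunLike.congr_fun h1 x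
      have h3 : ψ = ((MvPolynomial.aeval t : MvPolynomial (Fin s) ℚ →ₐ[ℚ] K) :
          MvPolynomial (Fin s) ℚ →+* K).comp ((θ : MvPolynomial (Fin s) ℚ →+* _).comp
            (MvPolynomial.map (Int.castRingHom ℚ))) := by
        apply MvPolynomial.ringHom_ext
        · intro r; simp [ψ]
        · intro i
          simp [ψ, t', θ, div_eq_inv_mul]
      rw [h3]
      exact (show Function.Injective (MvPolynomial.aeval t) from ht).comp
        (h2.comp (MvPolynomial.map_injective _ Int.cast_injective))
    let : Algebra (MvPolynomial (Fin s) ℤ) K := ψ.toAlgebra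
    have hSint : ∀ z ∈ S, IsIntegral (MvPolynomial (Fin s) ℤ) z := by
      intro z hz
      have : S ≤ (integralClosure (MvPolynomial (Fin s) ℤ) K).restrictScalars ℤ := by
        refine Algebra.adjoin_le ?_
        intro z hz
        simp only [Finset.coe_union, Finset.coe_image, Set.mem_union] at hz
        change IsIntegral (MvPolynomial (Fin s) ℤ) z
        rcases hz with ⟨i, -, rfl⟩ | ⟨x, hx, rfl⟩
        · have := isIntegral_algebraMap (R := MvPolynomial (Fin s) ℤ) (A := K)
            (x := MvPolynomial.X i)
          convert this using 1
          change _ = ψ _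
          simp [ψ]
        · obtain ⟨P, hP, hP'⟩ := hG x hx
          let η : MvPolynomial (Fin s) ℤ →+* MvPolynomial (Fin s) ℤ :=
            ((MvPolynomial.aeval fun i => (p : MvPolynomial (Fin s) ℤ) * MvPolynomial.X i :
              MvPolynomial (Fin s) ℤ →ₐ[ℤ] _) : MvPolynomial (Fin s) ℤ →+* _)
          refine ⟨P.map η, hP.map _, ?_⟩
          rw [Polynomial.eval₂_map]
          have hcomp : ψ.comp η = ((MvPolynomial.aeval t : MvPolynomial (Fin s) ℤ →ₐ[ℤ] K) :
              MvPolynomial (Fin s) ℤ →+* K) := by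
            apply MvPolynomial.ringHom_ext
            · intro r; simp [ψ, η]
            · intro i
              simp [ψ, η, t']
              field_simp
          rw [← hcomp] at hP'
          exact hP'
      exact this hz
    have hinj : Function.Injective (algebraMap (MvPolynomial (Fin s) ℤ) K) := hψinj
    have hy := hSint y y.2
    let B := integralClosure (MvPolynomial (Fin s) ℤ) K
    have hBint : (algebraMap (MvPolynomial (Fin s) ℤ) B).IsIntegral := fun b =>
      integralClosure.isIntegral b
    have hBinj : Function.Injective (algebraMap (MvPolynomial (Fin s) ℤ) B) := by
      intro a b hab
      exact hinj (congrArg Subtype.val hab)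
    have hloc := hBint.isLocalHom hBinj
    have hunit : IsUnit (algebraMap (MvPolynomial (Fin s) ℤ) B (p : MvPolynomial (Fin s) ℤ)) := by
      refine IsUnit.of_mul_eq_one (⟨y, hy⟩ : B) ?_
      apply Subtype.ext
      have := congrArg Subtype.val hay
      simpa using this
    have h4 : IsUnit (p : MvPolynomial (Fin s) ℤ) := hloc.map_nonunit _ hunit
    have h5 := h4.map (MvPolynomial.constantCoeff : MvPolynomial (Fin s) ℤ →+* ℤ)
    rw [map_natCast] at h5
    exact (Nat.prime_iff_prime_int.1 hp).not_isUnit h5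
  · intro x hx hx0 hx' y hy
    let Q := S ⧸ Ideal.span {(p : S)}
    let π : S →+* Q := Ideal.Quotient.mk _
    have hpQ' : (p : Q) = 0 := by
      have : π (p : S) = 0 := Ideal.Quotient.eq_zero_iff_mem.2 (Ideal.mem_span_singleton_self _)
      simpa using this
    have hyint : IsIntegral ℤ (π y) := by
      obtain ⟨P, hP, hP'⟩ := hG x hx
      let τ : MvPolynomial (Fin s) ℤ →+* S :=
        ((MvPolynomial.aeval fun i => (p : S) * (⟨t' i, ht'S i⟩ : S) :
          MvPolynomial (Fin s) ℤ →ₐ[ℤ] S) : MvPolynomial (Fin s) ℤ →+* S)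
      have h1 : P.eval₂ τ y = 0 := by
        apply Subtype.ext
        change (S.val : S →+* K) _ = 0
        rw [Polynomial.hom_eval₂]
        rw [← hP']
        congr 1
        · apply MvPolynomial.ringHom_ext
          · intro r; simp [τ]
          · intro i
            simp [τ, t']
            field_simp
      have h2 : π.comp τ = (algebraMap ℤ Q).comp MvPolynomial.constantCoeff := by
        apply MvPolynomial.ringHom_ext
        · intro r; simp [τ]
        · intro i
          simp [τ, hpQ']
      refine ⟨P.map MvPolynomial.constantCoeff, hP.map _, ?_⟩
      rw [Polynomial.eval₂_map, ← h2, ← Polynomial.hom_eval₂, h1, map_zero]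
    have hunit : IsUnit (π y) := by
      let y' : S := ⟨N * x⁻¹, hGS _ hx'⟩
      have h1 : y * y' = (N : S) ^ 2 := by
        apply Subtype.ext
        simp only [y', MulMemClass.coe_mul, hy]
        push_cast
        field_simp
      have hNu : IsUnit (N : Q) := by
        have := (Nat.isCoprime_iff_coprime.2 hpcop).map (Int.castRingHom Q)
        simp only [eq_intCast, Int.cast_natCast, hpQ'] at this
        exact isCoprime_zero_left.1 this
      have h2 : π y * π y' = (N : Q) ^ 2 := by rw [← map_mul, h1]; simp
      exact isUnit_of_mul_isUnit_left (h2 ▸ hNu.pow 2)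
    obtain ⟨M, hM, h⟩ := sml_unit p hp.ne_zero hpQ' (π y) hyint hunit
    refine ⟨M, hM, ?_⟩
    rw [← Ideal.mem_span_singleton, ← Ideal.Quotient.eq_zero_iff_mem]
    change π _ = 0
    rw [map_sub, map_pow, h, map_one, sub_self]

theorem sml_final {K : Type*} [Field K] [CharZero K] {ι : Type*} (s : Finset ι) (c μ : ι → K)
    (hμ : ∀ i ∈ s, μ i ≠ 0)
    (hdist : ∀ M : ℕ, 0 < M → ∀ i ∈ s, ∀ j ∈ s, μ i ^ M = μ j ^ M → i = j)
    (hinf : {n : ℕ | ∑ i ∈ s, c i * μ i ^ n = 0}.Infinite) : ∀ i ∈ s, c i = 0 := by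
  classical
  obtain ⟨p, N, S, hp, hN, hnoeth, hpu, hGS, hG⟩ :=
    sml_ring (s.image c ∪ s.image μ ∪ s.image (fun i => (μ i)⁻¹))
  have hNK : (N : K) ≠ 0 := by exact_mod_cast hN
  have hcS : ∀ i : s, (N : K) * c i ∈ S := fun i => hGS _ (by
    simp only [Finset.mem_union, Finset.mem_image]
    exact Or.inl (Or.inl ⟨i, i.2, rfl⟩))
  have hμG : ∀ i : s, μ i ∈ s.image c ∪ s.image μ ∪ s.image (fun i => (μ i)⁻¹) := fun i => by
    simp only [Finset.mem_union, Finset.mem_image]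
    exact Or.inl (Or.inr ⟨i, i.2, rfl⟩)
  have hμG' : ∀ i : s, (μ i)⁻¹ ∈ s.image c ∪ s.image μ ∪ s.image (fun i => (μ i)⁻¹) := fun i => by
    simp only [Finset.mem_union, Finset.mem_image]
    exact Or.inr ⟨i, i.2, rfl⟩
  let γ : s → S := fun i => ⟨N * c i, hcS i⟩
  let ν : s → S := fun i => ⟨N * μ i, hGS _ (hμG i)⟩
  have hsep : ∀ y : S, (∀ n, (p : S) ^ n ∣ y) → y = 0 := by
    intro y hy
    have h1 : Ideal.span {(p : S)} ≠ ⊤ := by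
      rwa [Ne, Ideal.span_singleton_eq_top]
    have h2 := Ideal.iInf_pow_eq_bot_of_isDomain _ h1
    rw [← Ideal.mem_bot, ← h2, Ideal.mem_iInf]
    intro n
    rw [Ideal.span_singleton_pow, Ideal.mem_span_singleton]
    exact hy n
  choose M hM0 hM using fun i : s => hG (μ i) (hμG i) (hμ i i.2) (hμG' i) (ν i) rfl
  let L : ℕ := (∏ i, M i) * p
  have hL0 : 0 < L := Nat.mul_pos (Finset.prod_pos fun i _ => hM0 i) hp.pos
  have hL : ∀ i, ∃ a : S, ν i ^ L = 1 + (p : S) ^ 2 * a := by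
    intro i
    have h1 : (p : S) ∣ ν i ^ (∏ i, M i) - 1 := by
      obtain ⟨e, he⟩ := Finset.dvd_prod_of_mem M (Finset.mem_univ i)
      rw [he, pow_mul]
      exact (hM i).trans (by simpa using sub_dvd_pow_sub_pow (ν i ^ M i) 1 e)
    have h2 := dvd_sub_pow_of_dvd_sub h1 1
    obtain ⟨a, ha⟩ := h2
    refine ⟨a, ?_⟩
    simp only [pow_one, one_pow] at ha
    rw [pow_mul]
    linear_combination ha
  choose a ha using hL
  obtain ⟨r, hr⟩ : ∃ r : ℕ, {n : ℕ | ∑ i ∈ s, c i * μ i ^ (L * n + r) = 0}.Infinite := by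
    by_contra! hcon
    apply hinf
    have hfin : (⋃ r ∈ Finset.range L, (fun n => L * n + r) ''
        {n : ℕ | ∑ i ∈ s, c i * μ i ^ (L * n + r) = 0}).Finite :=
      Set.Finite.biUnion (Finset.finite_toSet _)
        fun r _ => (hcon r).image _
    refine hfin.subset fun n hn => ?_
    simp only [Set.mem_iUnion]
    refine ⟨n % L, Finset.mem_range.2 (Nat.mod_lt _ hL0), n / L, ?_, Nat.div_add_mod n L⟩
    simp only [Set.mem_ofPred_eq, Nat.div_add_mod]
    exact hn
  have hconv : ∀ n : ℕ, ((∑ i ∈ (Finset.univ : Finset s),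
      (γ i * ν i ^ r) * (1 + (p : S) ^ 2 * a i) ^ n : S) : K) =
      (N : K) ^ (L * n + r + 1) * ∑ i ∈ s, c i * μ i ^ (L * n + r) := by
    intro n
    rw [← Finset.sum_coe_sort s, Finset.mul_sum]
    push_cast
    refine Finset.sum_congr rfl fun i _ => ?_
    have h1 := congrArg (Subtype.val) (ha i)
    push_cast at h1
    rw [← h1]
    simp only [γ, ν]
    ring
  have hall := sml_sum p hp hsep Finset.univ (fun i => γ i * ν i ^ r) a (by
    refine hr.mono fun n hn => ?_
    apply Subtype.ext
    refine (hconv n).trans ?_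
    rw [show ∑ i ∈ s, c i * μ i ^ (L * n + r) = 0 from hn, mul_zero]
    rfl)
  have hall' : ∀ n : ℕ, ∑ i : s, (c i * μ i ^ r) * (μ i ^ L) ^ n = 0 := by
    intro n
    have h1 := hconv n
    rw [hall n] at h1
    have h2 := (mul_eq_zero.1 h1.symm).resolve_left (pow_ne_zero _ hNK)
    rw [← Finset.sum_coe_sort s] at h2
    rw [← h2]
    refine Finset.sum_congr rfl fun i _ => ?_
    ring
  let e := Fintype.equivFin s
  have hv := Matrix.eq_zero_of_forall_pow_sum_mul_pow_eq_zero
    (f := fun j => μ (e.symm j) ^ L) (v := fun j => c (e.symm j) * μ (e.symm j) ^ r)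
    (fun j k hjk => e.symm.injective (Subtype.ext
      (hdist L hL0 _ (e.symm j).2 _ (e.symm k).2 hjk)))
    (fun i => by
      rw [← hall' i]
      exact Equiv.sum_comp e.symm (fun i' : s => (c i' * μ i' ^ r) * (μ i' ^ L) ^ (i : ℕ)))
  intro i hi
  have h1 := congrFun hv (e ⟨i, hi⟩)
  simp only [Equiv.symm_apply_apply, Pi.zero_apply] at h1
  exact (mul_eq_zero.1 h1).resolve_right (pow_ne_zero _ (hμ i hi))

/-- strengthened form: if `A = diag(λ₁,…,λ_k)` has multiplicatively
independent nonzero eigenvalues and `F ≠ 0`, then `F(λ₁^n,…,λ_k^n) = 0` for at most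
finitely many `n`; hence every infinite subset of the orbit of `(1,…,1)` is Zariski
dense. -/
theorem stmt11 {𝕜 : Type*} [Field 𝕜] [IsAlgClosed 𝕜] [CharZero 𝕜] {k : ℕ}
    (lam : Fin k → 𝕜) (h0 : ∀ i, lam i ≠ 0)
    (hindep : ∀ c : Fin k → ℤ, ∏ i, lam i ^ c i = 1 → c = 0)
    (F : MvPolynomial (Fin k) 𝕜) (hF : F ≠ 0) :
    {n : ℕ | MvPolynomial.eval (fun i => lam i ^ n) F = 0}.Finite := by
  by_contra hinf
  apply hF
  have hμ0 : ∀ d : Fin k →₀ ℕ, ∏ i, lam i ^ d i ≠ 0 := fun d =>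
    Finset.prod_ne_zero_iff.2 fun i _ => pow_ne_zero _ (h0 i)
  have key := sml_final F.support (fun d => F.coeff d) (fun d => ∏ i, lam i ^ d i)
    (fun d _ => hμ0 d) (by
      intro M hM d _ d' _ h
      have h1 : ∏ i, lam i ^ ((M : ℤ) * ((d i : ℤ) - d' i)) = 1 := by
        have h2 : ∏ i, lam i ^ ((M : ℤ) * ((d i : ℤ) - d' i)) =
            (∏ i, lam i ^ d i) ^ M / (∏ i, lam i ^ d' i) ^ M := by
          rw [← Finset.prod_pow, ← Finset.prod_pow, ← Finset.prod_div_distrib]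
          refine Finset.prod_congr rfl fun i _ => ?_
          rw [mul_comm, zpow_mul, zpow_sub₀ (h0 i), zpow_natCast, zpow_natCast, zpow_natCast,
            div_pow]
        rw [h2, h, div_self (pow_ne_zero _ (hμ0 d'))]
      have h3 := hindep _ h1
      ext i
      have h4 := congrFun h3 i
      simp only [Pi.zero_apply, mul_eq_zero] at h4
      omega) (by
      refine Set.Infinite.mono ?_ hinf
      intro n hn
      have hn' : MvPolynomial.eval (fun i => lam i ^ n) F = 0 := hn
      rw [MvPolynomial.eval_eq'] at hn'
      change _ = _
      rw [← hn']
      refine Finset.sum_congr rfl fun d _ => ?_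
      rw [← Finset.prod_pow]
      congr 1
      refine Finset.prod_congr rfl fun i _ => ?_
      rw [← pow_mul, ← pow_mul, mul_comm])
  ext d
  rw [MvPolynomial.coeff_zero]
  by_contra hd
  exact hd (key d (MvPolynomial.mem_support_iff.2 hd))
end

section
/- Let (a_n) be a linear recurrence sequence over an algebraically closed field 𝕜 of characteristic 0 with general term a_n = Σᵢ Qᵢ(n)·γᵢ^n, where the Qᵢ are nonzero polynomials and the γᵢ are distinct nonzero elements such that γᵢ/γⱼ is not a root of unity for any i ≠ j (a non-degenerate linear recurrence). Then a_n = 0 for at most finitely many n ∈ ℕ₀. -/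
open Filter Topology Polynomial in
/-- `f` has a Newton-type expansion with coefficients tending to zero. -/
def SMLInterp {L : Type*} [NormedField L] (f : ℕ → L) : Prop :=
  ∃ d : ℕ → L, Tendsto d atTop (𝓝 0) ∧
    ∀ n T : ℕ, n < T → f n = ∑ k ∈ Finset.range T, d k * (n.descFactorial k : L)

open Filter Topology Polynomial in
theorem SMLInterp.eq_zero {L : Type*} [NormedField L] [IsUltrametricDist L] [CharZero L]
    {f : ℕ → L} (hf : SMLInterp f) (hinf : {n | f n = 0}.Infinite) (m : ℕ) : f m = 0 := by
  obtain ⟨d, hd, hfd⟩ := hf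
  rw [← norm_le_zero_iff]
  refine le_of_forall_pos_le_add fun ε hε => ?_
  rw [zero_add]
  obtain ⟨M, hM⟩ := (Metric.tendsto_atTop.1 hd) ε hε
  obtain ⟨s, hs, hcard⟩ := hinf.exists_subset_card_eq M
  set T := m + s.sup id + 1 with hT
  have hsT : ∀ i ∈ s, i < T := fun i hi => by
    have : id i ≤ s.sup id := Finset.le_sup hi
    simp only [id] at this; omega
  let D : ℤ[X] := ∏ i ∈ s, (X - C (i : ℤ))
  have hDm : D.Monic := monic_prod_of_monic _ _ fun i _ => monic_X_sub_C _
  have hDdeg : D.degree = M := by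
    rw [degree_prod, Finset.sum_congr rfl fun i _ => degree_X_sub_C _]; simp [hcard]
  have hDi : ∀ i ∈ s, D.eval (i : ℤ) = 0 := fun i hi => by
    rw [eval_prod]; exact Finset.prod_eq_zero hi (by simp)
  let q : ℕ → ℤ[X] := fun k => descPochhammer ℤ k /ₘ D
  let r : ℕ → ℤ[X] := fun k => descPochhammer ℤ k %ₘ D
  have hqr : ∀ k n : ℕ, (n.descFactorial k : ℤ) =
      (r k).eval (n : ℤ) + D.eval (n : ℤ) * (q k).eval (n : ℤ) := fun k n => by
    rw [← descPochhammer_eval_eq_descFactorial ℤ n k, ← eval_mul, ← eval_add,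
      modByMonic_add_div]
  have hqr' : ∀ k n : ℕ, (n.descFactorial k : L) =
      (((r k).eval (n : ℤ) : ℤ) : L) + ((D.eval (n : ℤ) * (q k).eval (n : ℤ) : ℤ) : L) :=
    fun k n => by exact_mod_cast congrArg (Int.cast : ℤ → L) (hqr k n)
  let R : L[X] := ∑ k ∈ Finset.range T, C (d k) * (r k).map (Int.castRingHom L)
  have hReval : ∀ n : ℕ, R.eval (n : L) =
      ∑ k ∈ Finset.range T, d k * (((r k).eval (n : ℤ) : ℤ) : L) := fun n => by
    simp only [R, eval_finsetSum, eval_mul, eval_C]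
    refine Finset.sum_congr rfl fun k _ => ?_
    have := eval_intCast_map (Int.castRingHom L) (r k) (n : ℤ)
    rw [Int.cast_natCast] at this
    rw [this]; rfl
  have hfn : ∀ n < T, f n = R.eval (n : L) + ∑ k ∈ Finset.range T,
      d k * ((D.eval (n : ℤ) * (q k).eval (n : ℤ) : ℤ) : L) := fun n hn => by
    rw [hfd n T hn, hReval, ← Finset.sum_add_distrib]
    refine Finset.sum_congr rfl fun k _ => ?_
    rw [hqr', mul_add]
  have hR0 : R = 0 := by
    refine eq_zero_of_degree_lt_of_eval_index_eq_zero (v := fun n : ℕ => (n : L)) s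
      (Nat.cast_injective.injOn) ?_ fun i hi => ?_
    · rw [hcard]
      refine (Submodule.sum_mem (degreeLT L M) fun k _ => ?_) |> mem_degreeLT.1
      rw [mem_degreeLT]
      refine lt_of_le_of_lt ((degree_mul_le _ _).trans ((add_le_add degree_C_le degree_map_le).trans_eq (zero_add _))) ?_
      rw [← hDdeg]
      exact degree_modByMonic_lt _ hDm
    · have h1 := hfn i (hsT i hi)
      have h0 : f i = 0 := hs hi
      simpa [h0, hDi i hi] using h1.symm
  rw [hfn m (by omega), hR0, eval_zero, zero_add]
  refine IsUltrametricDist.norm_sum_le_of_forall_le_of_nonneg hε.le fun k _ => ?_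
  by_cases hk : k < M
  · have : q k = 0 := by
      rw [divByMonic_eq_zero_iff hDm, hDdeg]
      refine lt_of_le_of_lt degree_le_natDegree ?_
      rw [descPochhammer_natDegree]
      exact_mod_cast hk
    simp [this, hε.le]
  · have h1 := hM k (by omega)
    rw [dist_zero_right] at h1
    rw [norm_mul]
    calc _ ≤ ‖d k‖ * 1 := by
          gcongr; exact IsUltrametricDist.norm_intCast_le_one L _
      _ ≤ ε := by linarith

open Filter Topology in
theorem SMLInterp.zero {L : Type*} [NormedField L] : SMLInterp (0 : ℕ → L) :=
  ⟨0, tendsto_const_nhds, by simp⟩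

open Filter Topology in
theorem SMLInterp.add {L : Type*} [NormedField L] {f g : ℕ → L} (hf : SMLInterp f)
    (hg : SMLInterp g) : SMLInterp (f + g) := by
  obtain ⟨d, hd, hfd⟩ := hf
  obtain ⟨e, he, hge⟩ := hg
  refine ⟨fun k => d k + e k, by simpa using hd.add he, fun n T h => ?_⟩
  simp only [Pi.add_apply, hfd n T h, hge n T h, add_mul, Finset.sum_add_distrib]

open Filter Topology in
theorem SMLInterp.smul {L : Type*} [NormedField L] {f : ℕ → L} (hf : SMLInterp f) (c : L) :
    SMLInterp (fun n => c * f n) := by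
  obtain ⟨d, hd, hfd⟩ := hf
  refine ⟨fun k => c * d k, by simpa using hd.const_mul c, fun n T h => ?_⟩
  simp only [hfd n T h, Finset.mul_sum, mul_assoc]

open Filter Topology in
theorem SMLInterp.natMul {L : Type*} [NormedField L] [IsUltrametricDist L] {f : ℕ → L}
    (hf : SMLInterp f) : SMLInterp (fun n => (n : L) * f n) := by
  obtain ⟨d, hd, hfd⟩ := hf
  let d' : ℕ → L := fun k => match k with
    | 0 => 0
    | k + 1 => d k
  refine ⟨fun k => d' k + k * d k, ?_, fun n T h => ?_⟩
  · have h1 : Tendsto d' atTop (𝓝 0) := (tendsto_add_atTop_iff_nat 1).1 hd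
    have h2 : Tendsto (fun k : ℕ => (k : L) * d k) atTop (𝓝 0) := by
      refine squeeze_zero_norm (fun k => ?_) (tendsto_zero_iff_norm_tendsto_zero.1 hd)
      rw [norm_mul]
      exact mul_le_of_le_one_left (norm_nonneg _) (IsUltrametricDist.norm_natCast_le_one L k)
    simpa using h1.add h2
  · obtain ⟨S, rfl⟩ : ∃ S, T = S + 1 := ⟨T - 1, by omega⟩
    have key : ∀ k, (n : L) * n.descFactorial k = n.descFactorial (k + 1) + k * n.descFactorial k := by
      intro k
      rw [Nat.descFactorial_succ]
      rcases le_or_gt k n with hk | hk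
      · push_cast [Nat.cast_sub hk]; ring
      · simp [Nat.descFactorial_of_lt hk]
    have e1 : ∑ k ∈ Finset.range (S + 1), d' k * (n.descFactorial k : L) =
        ∑ k ∈ Finset.range (S + 1), d k * (n.descFactorial (k + 1) : L) := by
      rw [Finset.sum_range_succ', Finset.sum_range_succ, Nat.descFactorial_of_lt (n := n) (k := S + 1) h]
      simp [d']
    simp only [add_mul, Finset.sum_add_distrib]
    rw [e1, hfd n (S + 1) h, Finset.mul_sum, ← Finset.sum_add_distrib]
    refine Finset.sum_congr rfl fun k _ => ?_
    linear_combination d k * key k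

open Polynomial in
theorem SMLInterp.polyMul {L : Type*} [NormedField L] [IsUltrametricDist L] {f : ℕ → L}
    (hf : SMLInterp f) (P : L[X]) : SMLInterp (fun n => P.eval (n : L) * f n) := by
  induction P using Polynomial.induction_on' with
  | add p q hp hq =>
    simp only [eval_add, add_mul]
    exact hp.add hq
  | monomial k a =>
    simp only [eval_monomial, mul_assoc]
    refine SMLInterp.smul ?_ a
    induction k with
    | zero => simpa using hf
    | succ k ih => simpa only [pow_succ', mul_assoc] using ih.natMul

theorem SMLInterp.sum {L : Type*} [NormedField L] {ι : Type*} (s : Finset ι) (f : ι → ℕ → L)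
    (hf : ∀ i ∈ s, SMLInterp (f i)) : SMLInterp (fun n => ∑ i ∈ s, f i n) := by
  classical
  induction s using Finset.induction_on with
  | empty => exact SMLInterp.zero
  | insert a s ha ih =>
    simp only [Finset.sum_insert ha]
    exact (hf a (Finset.mem_insert_self _ _)).add
      (ih fun i hi => hf i (Finset.mem_insert_of_mem hi))

open Filter Topology in
theorem SMLInterp.pow {L : Type*} [NormedField L] [CharZero L] {u : L}
    (hu : Tendsto (fun k : ℕ => u ^ k / (k.factorial : L)) atTop (𝓝 0)) :
    SMLInterp (fun n => (1 + u) ^ n) := by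
  refine ⟨_, hu, fun n T h => ?_⟩
  have h1 : ∀ k, u ^ k / (k.factorial : L) * (n.descFactorial k : L) = u ^ k * n.choose k := by
    intro k
    rw [Nat.descFactorial_eq_factorial_mul_choose]
    have : (k.factorial : L) ≠ 0 := by exact_mod_cast k.factorial_ne_zero
    push_cast; field_simp
  simp only [h1]
  rw [add_comm, add_pow]
  simp only [one_pow, mul_one]
  refine Finset.sum_subset (by intro x; simp; omega) fun k _ hk => ?_
  rw [Nat.choose_eq_zero_of_lt (by simpa using hk)]; simp

open Filter Topology in
theorem sml_tendsto {p : ℕ} [hp : Fact p.Prime] {u : PadicAlgCl p} (hu : ‖u‖ ≤ ((p : ℝ)⁻¹) ^ 2) :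
    Tendsto (fun k : ℕ => u ^ k / (k.factorial : PadicAlgCl p)) atTop (𝓝 0) := by
  have hp1 : (1 : ℝ) < p := by exact_mod_cast hp.out.one_lt
  refine squeeze_zero_norm (a := fun k : ℕ => ((p : ℝ)⁻¹) ^ k) (fun k => ?_)
    (tendsto_pow_atTop_nhds_zero_of_lt_one (by positivity) (inv_lt_one_of_one_lt₀ hp1))
  have hk : ((p : ℝ)⁻¹) ^ k ≤ ‖(k.factorial : PadicAlgCl p)‖ := by
    have e : (k.factorial : PadicAlgCl p) = algebraMap ℚ_[p] (PadicAlgCl p) (k.factorial : ℚ_[p]) := by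
      simp
    rw [e, PadicAlgCl.norm_extends, Padic.norm_eq_zpow_neg_valuation
      (by exact_mod_cast k.factorial_ne_zero), Padic.valuation_natCast, zpow_neg, zpow_natCast,
      inv_pow]
    gcongr
    · exact hp1.le
    · rcases Nat.eq_zero_or_pos k with rfl | h
      · simp
      · exact (padicValNat_factorial_lt_of_ne_zero p h.ne').le
  rw [norm_div, norm_pow, div_le_iff₀ (lt_of_lt_of_le (by positivity) hk)]
  calc ‖u‖ ^ k ≤ (((p : ℝ)⁻¹) ^ 2) ^ k := by gcongr
    _ = ((p : ℝ)⁻¹) ^ k * ((p : ℝ)⁻¹) ^ k := by ring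
    _ ≤ _ := by gcongr


open Polynomial in
/-- Linear independence of exponential polynomials. -/
theorem sml_indep {K : Type*} [Field K] [CharZero K] {s : ℕ} (P : Fin s → K[X]) (β : Fin s → K)
    (hβ : Function.Injective β) (hβ0 : ∀ i, β i ≠ 0)
    (h : ∀ n : ℕ, ∑ i, (P i).eval (n : K) * β i ^ n = 0) (i : Fin s) : P i = 0 := by
  let E : Module.End K (ℕ → K) := LinearMap.funLeft K K Nat.succ
  let g : K[X] → K → ℕ → K := fun Q b n => Q.eval (n : K) * b ^ n
  have step : ∀ Q b, (E - b • (1 : Module.End K (ℕ → K))) (g Q b) = b • g (taylor 1 Q - Q) b := by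
    intro Q b
    funext n
    simp [E, g, LinearMap.funLeft_apply, taylor_eval, pow_succ]
    ring_nf
  have hmem : ∀ (k : ℕ) (Q : K[X]) (b : K), Q.degree < k →
      ((E - b • (1 : Module.End K (ℕ → K))) ^ k) (g Q b) = 0 := by
    intro k
    induction k with
    | zero =>
      intro Q b hQ
      have : Q = 0 := by
        by_contra hne
        exact absurd hQ (not_lt.2 (by simpa using zero_le_degree_iff.2 hne))
      subst this; funext n; simp [g]
    | succ k ih =>
      intro Q b hQ
      rw [pow_succ, Module.End.mul_apply, step, map_smul, ih, smul_zero]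
      by_cases h0 : Q = 0
      · subst h0; simp [bot_lt_iff_ne_bot]
      have hlt : (taylor 1 Q - Q).degree < (taylor 1 Q).degree :=
        degree_sub_lt_left (degree_taylor Q 1) (by rwa [Ne, taylor_eq_zero])
          (leadingCoeff_taylor 1 Q)
      rw [degree_taylor, degree_eq_natDegree h0] at hlt
      rw [degree_eq_natDegree h0] at hQ
      refine lt_of_lt_of_le hlt ?_
      have : Q.natDegree < k + 1 := by exact_mod_cast hQ
      exact_mod_cast Nat.lt_succ_iff.1 this
  have hm : ∀ i, g (P i) (β i) ∈ E.maxGenEigenspace (β i) := fun i => by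
    rw [Module.End.mem_maxGenEigenspace]
    refine ⟨(P i).natDegree + 1, hmem _ _ _ ?_⟩
    exact lt_of_le_of_lt degree_le_natDegree (by exact_mod_cast Nat.lt_succ_self _)
  have hind := (E.independent_maxGenEigenspace).comp hβ
  have hz : g (P i) (β i) = 0 := by
    have hd := hind i
    rw [Submodule.disjoint_def] at hd
    refine hd _ (hm i) ?_
    have hsum : g (P i) (β i) = - ∑ j ∈ Finset.univ.erase i, g (P j) (β j) := by
      rw [eq_neg_iff_add_eq_zero, Finset.add_sum_erase _ (fun j => g (P j) (β j)) (Finset.mem_univ i)]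
      funext n; simpa [g] using h n
    rw [hsum]
    refine Submodule.neg_mem _ (Submodule.sum_mem _ fun j hj => ?_)
    exact Submodule.mem_iSup_of_mem j (Submodule.mem_iSup_of_mem (Finset.ne_of_mem_erase hj) (hm j))
  refine eq_zero_of_infinite_isRoot _ (Set.Infinite.mono (s := Set.range (Nat.cast : ℕ → K)) ?_
    (Set.infinite_range_of_injective Nat.cast_injective))
  rintro _ ⟨n, rfl⟩
  have := congrFun hz n
  simpa [g, hβ0 i] using this


theorem sml_algIndep (p : ℕ) [hp : Fact p.Prime] (ι : Type*) [Countable ι] (a : ι → ℤ) :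
    ∃ t : ι → ℤ_[p], AlgebraicIndependent ℤ (fun i => (t i : ℚ_[p])) ∧
      ∀ i, PadicInt.toZMod (t i) = (a i : ZMod p) := by
  obtain ⟨κ, w, hw⟩ := exists_isTranscendenceBasis' ℚ ℚ_[p]
  have hκ : Infinite κ := by
    by_contra hfin
    rw [not_infinite_iff_finite] at hfin
    have := hw.isAlgebraic
    have h1 := Algebra.IsAlgebraic.cardinalMk_le_max (Algebra.adjoin ℚ (Set.range w)) ℚ_[p]
    have h2 : Cardinal.mk (Algebra.adjoin ℚ (Set.range w)) ≤ Cardinal.aleph0 := by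
      have : Countable (MvPolynomial κ ℚ) := by
        rw [← Cardinal.mk_le_aleph0_iff]
        refine MvPolynomial.cardinalMk_le_max_lift.trans ?_
        simp
      have : Countable (Algebra.adjoin ℚ (Set.range w)) :=
        hw.1.aevalEquiv.symm.injective.countable
      exact Cardinal.mk_le_aleph0
    have h3 := continuum_le_cardinal_of_nontriviallyNormedField ℚ_[p]
    have h4 := h3.trans (h1.trans (max_le h2 le_rfl))
    exact absurd Cardinal.aleph0_lt_continuum (not_lt.2 h4)
  obtain ⟨f, hf⟩ := exists_injective_nat ι
  let e : ι → κ := fun i => Infinite.natEmbedding κ (f i)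
  have he : Function.Injective e := (Infinite.natEmbedding κ).injective.comp hf
  have hv : AlgebraicIndependent ℚ (w ∘ e) := hw.1.comp e he
  have hn : ∀ i, ∃ n : ℕ, ‖(p : ℚ_[p]) ^ n * w (e i)‖ ≤ 1 := by
    intro i
    have hp1 : (1 : ℝ) < p := by exact_mod_cast hp.out.one_lt
    obtain ⟨n, hn⟩ := pow_unbounded_of_one_lt ‖w (e i)‖ hp1
    refine ⟨n, ?_⟩
    rw [norm_mul, norm_pow, Padic.norm_p, inv_pow, inv_mul_le_iff₀ (by positivity)]
    linarith
  choose n hn using hn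
  have hb : ∀ i, ∃ b : ℤ_[p], (b : ℚ_[p]) = (p : ℚ_[p]) ^ n i * w (e i) :=
    fun i => ⟨⟨_, hn i⟩, rfl⟩
  choose b hb using hb
  let t : ι → ℤ_[p] := fun i => a i + p * b i
  have hp0 : (p : ℚ) ≠ 0 := by exact_mod_cast hp.out.ne_zero
  refine ⟨t, ?_, fun i => by simp [t]⟩
  refine AlgebraicIndependent.restrictScalars (K := ℚ) (by
    exact (algebraMap ℤ ℚ).injective_int) ?_
  let F : MvPolynomial ι ℚ →ₐ[ℚ] MvPolynomial ι ℚ :=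
    MvPolynomial.aeval fun i => MvPolynomial.C (a i : ℚ) + MvPolynomial.C ((p : ℚ) ^ (n i + 1)) * MvPolynomial.X i
  let G : MvPolynomial ι ℚ →ₐ[ℚ] MvPolynomial ι ℚ :=
    MvPolynomial.aeval fun i => MvPolynomial.C (((p : ℚ) ^ (n i + 1))⁻¹) * (MvPolynomial.X i - MvPolynomial.C (a i : ℚ))
  have hGF : G.comp F = AlgHom.id ℚ _ := by
    ext1 i
    have h1 : G (MvPolynomial.C (a i : ℚ)) = MvPolynomial.C (a i : ℚ) := G.commutes _
    have h2 : G (MvPolynomial.C ((p : ℚ) ^ (n i + 1))) = MvPolynomial.C ((p : ℚ) ^ (n i + 1)) :=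
      G.commutes _
    simp only [AlgHom.comp_apply, F, MvPolynomial.aeval_X, map_add, map_mul, h1, h2]
    simp only [G, MvPolynomial.aeval_X, ← mul_assoc, ← MvPolynomial.C_mul]
    rw [mul_inv_cancel₀ (pow_ne_zero _ hp0)]
    simp
  have hF : Function.Injective F := by
    refine Function.LeftInverse.injective (g := G) fun x => ?_
    exact DFunLike.congr_fun hGF x
  have : (MvPolynomial.aeval fun i => (t i : ℚ_[p]) : MvPolynomial ι ℚ →ₐ[ℚ] ℚ_[p]) =
      (MvPolynomial.aeval (w ∘ e)).comp F := by
    ext1 i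
    simp only [AlgHom.comp_apply, F, MvPolynomial.aeval_X, map_add, map_mul, t]
    simp [pow_succ, hb]
    ring
  unfold AlgebraicIndependent
  rw [this]
  rw [AlgHom.coe_comp]
  exact Function.Injective.comp (show Function.Injective _ from hv) hF

theorem sml_norm_integral {L : Type*} [NormedField L] [IsUltrametricDist L] {R K : Type*}
    [CommRing R] [Field K] [Algebra R K] (φ : K →+* L)
    (hR : ∀ r : R, ‖φ (algebraMap R K r)‖ ≤ 1) {z : K} (hz : IsIntegral R z) : ‖φ z‖ ≤ 1 := by
  let v : Valuation L NNReal := NormedField.valuation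
  have h := IsIntegral.map_of_comp_eq (T := v.integer) (U := L)
    ((φ.comp (algebraMap R K)).codRestrict v.integer fun r => hR r) φ (by ext; rfl) hz
  exact (Valuation.integer.integers v).mem_of_integral h

theorem sml_embed {K : Type*} [Field K] [CharZero K] [Countable K] {s : ℕ} (γ : Fin s → K)
    (hγ : ∀ i, γ i ≠ 0) :
    ∃ (p : ℕ) (_ : Fact p.Prime) (φ : K →+* PadicAlgCl p), ∀ i, ‖φ (γ i)‖ = 1 := by
  obtain ⟨ι, x, hx⟩ := exists_isTranscendenceBasis' ℤ K
  have hxinj : Function.Injective x := hx.1.injective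
  have : Countable ι := hxinj.countable
  let algK : Algebra (MvPolynomial ι ℤ) K := (MvPolynomial.aeval x).toRingHom.toAlgebra
  have hinjK : Function.Injective (algebraMap (MvPolynomial ι ℤ) K) := hx.1
  have halg : Algebra.IsAlgebraic (MvPolynomial ι ℤ) K := by
    have := hx.isAlgebraic
    refine Algebra.IsAlgebraic.of_ringHom_of_comp_eq (S := Algebra.adjoin ℤ (Set.range x))
      (B := K) hx.1.aevalEquiv (RingHom.id K) hx.1.aevalEquiv.surjective
      Function.injective_id ?_
    apply RingHom.ext
    intro q
    simp
    rfl
  have h1 := fun i => (halg.isAlgebraic (γ i)).exists_integral_multiple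
  have h2 := fun i => (halg.isAlgebraic (γ i)⁻¹).exists_integral_multiple
  choose y hy0 hy using h1
  choose y' hy0' hy' using h2
  have hg : (∏ i, y i * y' i) ≠ 0 :=
    Finset.prod_ne_zero_iff.2 fun i _ => mul_ne_zero (hy0 i) (hy0' i)
  obtain ⟨a, ha⟩ : ∃ a : ι → ℤ, MvPolynomial.eval a (∏ i, y i * y' i) ≠ 0 := by
    by_contra hcon
    push Not at hcon
    exact hg (MvPolynomial.funext fun a => by rw [hcon a, map_zero])
  obtain ⟨p, hple, hpp⟩ := Nat.exists_infinite_primes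
    ((MvPolynomial.eval a (∏ i, y i * y' i)).natAbs + 1)
  have hpF : Fact p.Prime := ⟨hpp⟩
  have hmod : ∀ q, q ∣ (∏ i, y i * y' i) → ((MvPolynomial.eval a q : ℤ) : ZMod p) ≠ 0 := by
    rintro q ⟨r, hr⟩ h0
    rw [ZMod.intCast_zmod_eq_zero_iff_dvd] at h0
    have : (p : ℤ) ∣ MvPolynomial.eval a (∏ i, y i * y' i) := by
      rw [hr, map_mul]; exact h0.mul_right _
    have := Nat.le_of_dvd (Int.natAbs_pos.2 ha) (Int.natCast_dvd.1 this)
    omega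
  obtain ⟨t, ht, hta⟩ := sml_algIndep p ι a
  let ψ0 : MvPolynomial ι ℤ →+* ℤ_[p] := (MvPolynomial.aeval t).toRingHom
  let ψ : MvPolynomial ι ℤ →+* PadicAlgCl p :=
    (algebraMap ℚ_[p] (PadicAlgCl p)).comp (PadicInt.Coe.ringHom.comp ψ0)
  have hψ0 : ∀ q, ((ψ0 q : ℤ_[p]) : ℚ_[p]) = MvPolynomial.aeval (fun i => (t i : ℚ_[p])) q := by
    intro q
    have : (PadicInt.Coe.ringHom.comp ψ0) =
      (MvPolynomial.aeval (fun i => (t i : ℚ_[p])) : MvPolynomial ι ℤ →ₐ[ℤ] ℚ_[p]).toRingHom := by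
      apply MvPolynomial.ringHom_ext
      · intro r; simp
      · intro i; simp [ψ0]; rfl
    exact DFunLike.congr_fun this q
  have hψinj : Function.Injective ψ := by
    refine (algebraMap ℚ_[p] (PadicAlgCl p)).injective.comp ?_
    intro q q' h
    refine ht ?_
    rw [← hψ0, ← hψ0]
    exact h
  have hψnorm : ∀ q, ‖ψ q‖ = ‖ψ0 q‖ := fun q => by
    simp only [ψ, RingHom.comp_apply, PadicAlgCl.norm_extends]; rfl
  have hψle : ∀ q, ‖ψ q‖ ≤ 1 := fun q => by
    rw [hψnorm]; exact PadicInt.norm_le_one _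
  have hψ1 : ∀ q, q ∣ (∏ i, y i * y' i) → ‖ψ q‖ = 1 := fun q hq => by
    rw [hψnorm, ← PadicInt.isUnit_iff]
    by_contra hu
    refine hmod q hq ?_
    have hmem : ψ0 q ∈ IsLocalRing.maximalIdeal ℤ_[p] := hu
    rw [← PadicInt.ker_toZMod, RingHom.mem_ker] at hmem
    rw [← hmem]
    have : (PadicInt.toZMod.comp ψ0) = (Int.castRingHom (ZMod p)).comp (MvPolynomial.eval a) := by
      apply MvPolynomial.ringHom_ext
      · intro r; simp
      · intro i; simp [ψ0, hta]
    exact (DFunLike.congr_fun this q).symm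
  let algL : Algebra (MvPolynomial ι ℤ) (PadicAlgCl p) := ψ.toAlgebra
  have : FaithfulSMul (MvPolynomial ι ℤ) K := (faithfulSMul_iff_algebraMap_injective _ _).2 hinjK
  have : FaithfulSMul (MvPolynomial ι ℤ) (PadicAlgCl p) :=
    (faithfulSMul_iff_algebraMap_injective _ _).2 hψinj
  let φ : K →ₐ[MvPolynomial ι ℤ] PadicAlgCl p := IsAlgClosed.lift
  have hφ : ∀ q, φ (algebraMap _ K q) = ψ q := fun q => φ.commutes q
  have hle : ∀ (q : MvPolynomial ι ℤ) (z : K), q ∣ (∏ i, y i * y' i) →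
      IsIntegral (MvPolynomial ι ℤ) (q • z) → ‖φ z‖ ≤ 1 := by
    intro q z hq hz
    have := sml_norm_integral φ.toRingHom (fun r => (congrArg norm (hφ r)).trans_le (hψle r)) hz
    rw [Algebra.smul_def] at this
    have h3 : φ.toRingHom (algebraMap _ K q * z) = ψ q * φ z := by
      rw [map_mul]; exact congrArg (· * φ z) (hφ q)
    rwa [h3, norm_mul, hψ1 q hq, one_mul] at this
  refine ⟨p, hpF, φ.toRingHom, fun i => le_antisymm ?_ ?_⟩
  · exact hle (y i) _ ((dvd_mul_right _ _).trans (Finset.dvd_prod_of_mem _ (Finset.mem_univ i))) (hy i)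
  · have := hle (y' i) _ ((dvd_mul_left _ _).trans (Finset.dvd_prod_of_mem _ (Finset.mem_univ i))) (hy' i)
    rw [map_inv₀, norm_inv] at this
    have h0 : 0 < ‖φ (γ i)‖ := norm_pos_iff.2 ((map_ne_zero φ).2 (hγ i))
    exact (inv_le_one₀ h0).1 this

open Filter Topology in
theorem sml_exists_pow {p : ℕ} [hp : Fact p.Prime] (z : PadicAlgCl p) (hz : ‖z‖ = 1) {ε : ℝ}
    (hε : 0 < ε) : ∃ N : ℕ, 0 < N ∧ ‖z ^ N - 1‖ ≤ ε := by
  let V : Submodule ℚ_[p] (PadicAlgCl p) := Subalgebra.toSubmodule (Algebra.adjoin ℚ_[p] {z})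
  have hzi : IsIntegral ℚ_[p] z := Algebra.IsIntegral.isIntegral z
  have hfin : FiniteDimensional ℚ_[p] V := Module.Finite.iff_fg.2 hzi.fg_adjoin_singleton
  have hprop : ProperSpace V := FiniteDimensional.proper ℚ_[p] V
  let x : ℕ → V := fun n => ⟨z ^ n, Subalgebra.pow_mem _ (Algebra.self_mem_adjoin_singleton _ _) n⟩
  have hx : ∀ n, x n ∈ Metric.closedBall (0 : V) 1 := fun n => by
    rw [mem_closedBall_zero_iff]
    change ‖z ^ n‖ ≤ 1
    simp [hz]
  obtain ⟨l, _, f, hf, hl⟩ := (isCompact_closedBall (0 : V) 1).tendsto_subseq hx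
  obtain ⟨M, hM⟩ := Metric.cauchySeq_iff.1 hl.cauchySeq ε hε
  have h1 := hM (M + 1) (by omega) M le_rfl
  have hlt : f M < f (M + 1) := hf (Nat.lt_succ_self M)
  refine ⟨f (M + 1) - f M, by omega, ?_⟩
  have h2 : ‖z ^ f (M + 1) - z ^ f M‖ < ε := by
    rw [dist_eq_norm] at h1
    exact h1
  have h3 : z ^ f (M + 1) - z ^ f M = z ^ f M * (z ^ (f (M + 1) - f M) - 1) := by
    rw [mul_sub, ← pow_add, mul_one, Nat.add_sub_cancel' hlt.le]
  rw [h3, norm_mul, norm_pow, hz, one_pow, one_mul] at h2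
  exact h2.le

theorem sml_norm_pow_sub_one {L : Type*} [NormedField L] [IsUltrametricDist L] {z : L}
    (hz : ‖z‖ = 1) (k : ℕ) : ‖z ^ k - 1‖ ≤ ‖z - 1‖ := by
  rw [← mul_geom_sum, norm_mul]
  refine mul_le_of_le_one_right (norm_nonneg _) ?_
  refine IsUltrametricDist.norm_sum_le_of_forall_le_of_nonneg zero_le_one fun i _ => ?_
  simp [hz]

open Polynomial in
theorem sml_countable {K : Type*} [Field K] [CharZero K] [Countable K] {s : ℕ}
    (hs : 0 < s)
    (Q : Fin s → K[X]) (hQ : ∀ i, Q i ≠ 0)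
    (γ : Fin s → K) (hγ : ∀ i, γ i ≠ 0)
    (hnd : ∀ i j : Fin s, i ≠ j → ∀ m : ℕ, 0 < m → (γ i / γ j) ^ m ≠ 1) :
    {n : ℕ | ∑ i, (Q i).eval (n : K) * γ i ^ n = 0}.Finite := by
  by_contra hinf
  obtain ⟨p, hp, φ, hφ⟩ := sml_embed γ hγ
  have hp0 : (0 : ℝ) < p := by exact_mod_cast hp.out.pos
  have h1 := fun i => sml_exists_pow (φ (γ i)) (hφ i) (ε := ((p : ℝ)⁻¹) ^ 2) (by positivity)
  choose N0 hN0 hN0' using h1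
  let N := ∏ i, N0 i
  have hN : 0 < N := Finset.prod_pos fun i _ => hN0 i
  have hNu : ∀ i, ‖φ (γ i) ^ N - 1‖ ≤ ((p : ℝ)⁻¹) ^ 2 := fun i => by
    obtain ⟨c, hc⟩ : N0 i ∣ N := Finset.dvd_prod_of_mem _ (Finset.mem_univ i)
    rw [hc, pow_mul]
    exact (sml_norm_pow_sub_one (by simp [hφ]) c).trans (hN0' i)
  obtain ⟨r, hr⟩ : ∃ r : ℕ,
      {m : ℕ | ∑ i, (Q i).eval ((r + N * m : ℕ) : K) * γ i ^ (r + N * m) = 0}.Infinite := by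
    by_contra hcon
    simp only [not_exists, Set.not_infinite] at hcon
    refine hinf (Set.Finite.subset (Set.Finite.biUnion (Set.finite_lt_nat N)
      fun r _ => (hcon r).image fun m => r + N * m) ?_)
    intro n hn
    simp only [Set.mem_iUnion]
    refine ⟨n % N, Nat.mod_lt _ hN, n / N, ?_, Nat.mod_add_div n N⟩
    simp only [Set.mem_ofPred_eq, Nat.mod_add_div]
    exact hn
  let P : Fin s → K[X] := fun i => C (γ i ^ r) * (Q i).comp (C (r : K) + C (N : K) * X)
  have hPe : ∀ m : ℕ, ∑ i, (Q i).eval ((r + N * m : ℕ) : K) * γ i ^ (r + N * m) =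
      ∑ i, (P i).eval (m : K) * (γ i ^ N) ^ m := fun m => by
    refine Finset.sum_congr rfl fun i _ => ?_
    simp [P, pow_add, pow_mul]
    ring
  let f : ℕ → PadicAlgCl p := fun m => φ (∑ i, (P i).eval (m : K) * (γ i ^ N) ^ m)
  have hf : SMLInterp f := by
    have : f = fun m : ℕ => ∑ i, ((P i).map φ).eval (m : PadicAlgCl p) *
        (1 + (φ (γ i) ^ N - 1)) ^ m := by
      funext m
      simp only [f, map_sum, map_mul, map_pow]
      refine Finset.sum_congr rfl fun i _ => ?_
      have := eval_natCast_map φ (P i) m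
      rw [this]; congr 2; ring
    rw [this]
    exact SMLInterp.sum _ _ fun i _ => (SMLInterp.pow (sml_tendsto (hNu i))).polyMul _
  have hzero : ∀ m : ℕ, ∑ i, (P i).eval (m : K) * (γ i ^ N) ^ m = 0 := fun m => by
    have := hf.eq_zero (hr.mono fun m hm => by
      simp only [Set.mem_ofPred_eq] at hm ⊢
      simp only [f]
      rw [← hPe, hm, map_zero]) m
    exact (map_eq_zero φ).1 this
  have hinj : Function.Injective fun i => γ i ^ N := by
    intro i j hij
    by_contra hne
    refine hnd i j hne N hN ?_
    rw [div_pow]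
    simp only at hij
    rw [hij, div_self (pow_ne_zero _ (hγ j))]
  have hP0 := sml_indep P _ hinj (fun i => pow_ne_zero _ (hγ i)) hzero ⟨0, hs⟩
  have hNK : (N : K) ≠ 0 := by exact_mod_cast hN.ne'
  simp only [P, mul_eq_zero, C_eq_zero, pow_eq_zero_iff', hγ, false_and, false_or] at hP0
  rw [comp_eq_zero_iff] at hP0
  rcases hP0 with h | ⟨_, h⟩
  · exact hQ _ h
  · have := congrArg (fun q => coeff q 1) h
    simp [coeff_natCast_ite] at this
    exact hN.ne.symm this

/-- Skolem–Mahler–Lech, non-degenerate case: a non-degenerate linear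
recurrence `a_n = Σᵢ Qᵢ(n)·γᵢ^n` (nonzero polynomials `Qᵢ`, distinct nonzero roots
`γᵢ` with no ratio `γᵢ/γⱼ` a root of unity) vanishes for at most finitely many `n`. -/
theorem stmt12 {𝕜 : Type*} [Field 𝕜] [IsAlgClosed 𝕜] [CharZero 𝕜] {s : ℕ}
    (hs : 0 < s)
    (Q : Fin s → Polynomial 𝕜) (hQ : ∀ i, Q i ≠ 0)
    (γ : Fin s → 𝕜) (hγ : ∀ i, γ i ≠ 0) (hdist : Function.Injective γ)
    (hnd : ∀ i j : Fin s, i ≠ j → ∀ m : ℕ, 0 < m → (γ i / γ j) ^ m ≠ 1) :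
    {n : ℕ | ∑ i, (Q i).eval (n : 𝕜) * γ i ^ n = 0}.Finite := by
  let S : Set 𝕜 := Set.range γ ∪ Set.range (fun x : Fin s × ℕ => (Q x.1).coeff x.2)
  let K : Subfield 𝕜 := Subfield.closure S
  have hS : S.Countable := (Set.countable_range _).union (Set.countable_range _)
  have hK : Countable K := by
    rw [← Cardinal.mk_le_aleph0_iff]
    exact (Subfield.cardinalMk_closure_le_max S).trans (max_le hS.le_aleph0 le_rfl)
  have hγK : ∀ i, γ i ∈ K := fun i => Subfield.subset_closure (Or.inl ⟨i, rfl⟩)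
  have hQK : ∀ i, ∃ q : Polynomial K, q.map K.subtype = Q i := fun i => by
    rw [← Polynomial.mem_lifts, Polynomial.lifts_iff_coeff_lifts]
    intro n
    exact ⟨⟨(Q i).coeff n, Subfield.subset_closure (Or.inr ⟨(i, n), rfl⟩)⟩, rfl⟩
  choose q hq using hQK
  let g : Fin s → K := fun i => ⟨γ i, hγK i⟩
  have main := sml_countable hs q (fun i h => hQ i (by rw [← hq, h, Polynomial.map_zero])) g
    (fun i h => hγ i (congrArg K.subtype h))
    (fun i j hij m hm h => hnd i j hij m hm (by simpa [g] using congrArg K.subtype h))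
  refine main.subset fun n hn => ?_
  simp only [Set.mem_ofPred_eq] at hn ⊢
  apply K.subtype.injective
  rw [map_zero, ← hn, map_sum]
  refine Finset.sum_congr rfl fun i _ => ?_
  rw [map_mul, map_pow, ← hq i, Polynomial.eval_natCast_map]
  rfl
end

section
/- Let 𝕜 be an algebraically closed field of characteristic 0 and Φ : 𝕜^k → 𝕜^k a dominant (equivalently, invertible) linear endomorphism with matrix A. Then the following are equivalent: (i) Φ preserves a non-constant rational function; (ii) no point of 𝕜^k has Zariski dense orbit under Φ; (iii) either A is diagonalizable with multiplicatively dependent eigenvalues, or A has at most k−2 multiplicatively independent eigenvalues. -/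
open MvPolynomial

/-- Linear independence of the sequences `n ^ a * μ ^ n`. -/
theorem aux_expo {𝕜 : Type*} [Field 𝕜] [CharZero 𝕜] {ι : Type*} (s : Finset ι)
    (c : ι → 𝕜) (a : ι → ℕ) (μ : ι → 𝕜) (hμ : ∀ i ∈ s, μ i ≠ 0)
    (hinj : ∀ i ∈ s, ∀ j ∈ s, a i = a j → μ i = μ j → i = j)
    (h : ∀ n : ℕ, ∑ i ∈ s, c i * ((n : 𝕜) ^ a i * μ i ^ n) = 0) :
    ∀ i ∈ s, c i = 0 := by
  classical
  let P : 𝕜 → Polynomial 𝕜 := fun m => ∑ i ∈ s with μ i = m, Polynomial.C (c i) * Polynomial.X ^ a i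
  let f : 𝕜 → (ℕ → 𝕜) := fun m n => (P m).eval (n : 𝕜) * m ^ n
  let S : Module.End 𝕜 (ℕ → 𝕜) := 
    { toFun := fun g n => g (n + 1), map_add' := fun _ _ => rfl, map_smul' := fun _ _ => rfl }
  have key : ∀ (m : 𝕜) (d : ℕ) (g : ℕ → 𝕜),
      ((S - algebraMap 𝕜 _ m) ^ d) (fun n => g n * m ^ n)
        = fun n => m ^ d * (((fwdDiff 1)^[d] g) n * m ^ n) := by
    intro m d
    induction d with
    | zero => intro g; simp
    | succ d ih =>
      intro g
      have h1 : (S - algebraMap 𝕜 _ m) (fun n => g n * m ^ n)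
          = m • (fun n => (fwdDiff 1 g) n * m ^ n) := by
        funext n
        simp [S, fwdDiff, Module.algebraMap_end_apply]
        ring
      rw [pow_succ, Module.End.mul_apply, h1, map_smul, ih]
      funext n
      simp [pow_succ]
      ring
  have hmem : ∀ m, f m ∈ S.maxGenEigenspace m := by
    intro m
    rw [Module.End.mem_maxGenEigenspace]
    refine ⟨(P m).natDegree + 1, ?_⟩
    have := key m ((P m).natDegree + 1) (fun n => (P m).eval (n : 𝕜))
    have e : m • (1 : Module.End 𝕜 (ℕ → 𝕜)) = algebraMap 𝕜 _ m := by
      rw [Algebra.algebraMap_eq_smul_one]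
    rw [e]
    refine this.trans ?_
    have hz : ∀ (d : ℕ) (g : 𝕜 → 𝕜) (n : ℕ),
        ((fwdDiff (1 : ℕ))^[d] (fun n : ℕ => g n)) n = ((fwdDiff (1 : 𝕜))^[d] g) n := by
      intro d
      induction d with
      | zero => intro g n; rfl
      | succ d ih =>
        intro g n
        rw [Function.iterate_succ_apply, Function.iterate_succ_apply, ← ih]
        have : (fwdDiff (1 : ℕ) fun n : ℕ => g n) = fun n : ℕ => (fwdDiff (1 : 𝕜) g) n := by
          funext n
          simp [fwdDiff]
        rw [this]
    funext n
    rw [hz _ (fun x => (P m).eval x), Polynomial.fwdDiff_iter_degree_add_one_eq_zero]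
    simp
  have hsum : ∑ m ∈ s.image μ, f m = 0 := by
    funext n
    rw [Finset.sum_apply, Pi.zero_apply, ← h n,
      ← Finset.sum_fiberwise_of_maps_to (s := s) (t := s.image μ) (g := μ)
        (fun i hi => Finset.mem_image_of_mem _ hi)]
    refine Finset.sum_congr rfl fun m _ => ?_
    simp only [f, P, Polynomial.eval_finsetSum, Finset.sum_mul]
    refine Finset.sum_congr rfl fun i hi => ?_
    rw [(Finset.mem_filter.1 hi).2]
    simp [mul_assoc]
  have hind := (iSupIndep_iff_finsetSum_eq_zero_imp_eq_zero _).1 S.independent_maxGenEigenspace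
    (s.image μ) f (fun m _ => hmem m) hsum
  intro i hi
  have h0 := hind (μ i) (Finset.mem_image_of_mem _ hi)
  have hP : P (μ i) = 0 := by
    refine Polynomial.eq_zero_of_infinite_isRoot _ ?_
    refine Set.Infinite.mono ?_ (Set.infinite_range_of_injective (Nat.cast_injective (R := 𝕜)))
    rintro _ ⟨n, rfl⟩
    have := congrFun h0 n
    simpa [f, hμ i hi] using this
  have hc := congrArg (fun p => Polynomial.coeff p (a i)) hP
  simp only [P, Polynomial.finsetSum_coeff, Polynomial.coeff_C_mul, Polynomial.coeff_X_pow,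
    Polynomial.coeff_zero] at hc
  rw [Finset.sum_eq_single i] at hc
  · simpa using hc
  · intro j hj hji
    rw [Finset.mem_filter] at hj
    rw [if_neg, mul_zero]
    intro e
    exact hji (hinj j hj.1 i hi e.symm hj.2)
  · intro hn
    exact (hn (Finset.mem_filter.2 ⟨hi, rfl⟩)).elim

/-- Density of exponential-polynomial orbits. -/
theorem aux_dense {𝕜 : Type*} [Field 𝕜] [CharZero 𝕜] {τ : Type*} [Fintype τ]
    (a : τ → ℕ) (ν b : τ → 𝕜) (hν : ∀ t, ν t ≠ 0) (hb : ∀ t, b t ≠ 0)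
    (hind : ∀ d : τ → ℤ, ∑ t, (a t : ℤ) * d t = 0 → ∏ t, ν t ^ d t = 1 → d = 0)
    (G : MvPolynomial τ 𝕜)
    (hG : ∀ n : ℕ, eval (fun t => b t * ((n : 𝕜) ^ a t * ν t ^ n)) G = 0) : G = 0 := by
  classical
  have h := aux_expo G.support (fun d => G.coeff d * ∏ t, b t ^ d t) (fun d => ∑ t, a t * d t)
    (fun d => ∏ t, ν t ^ d t) (fun d _ => Finset.prod_ne_zero_iff.2 fun t _ => pow_ne_zero _ (hν t))
    ?_ ?_
  · ext d
    by_contra hd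
    have := h d (by simpa [MvPolynomial.mem_support_iff] using hd)
    rcases mul_eq_zero.1 this with h1 | h1
    · exact hd (by simpa using h1)
    · exact (Finset.prod_ne_zero_iff.2 fun t _ => pow_ne_zero _ (hb t)) h1
  · intro d _ e _ h1 h2
    have := hind (fun t => (d t : ℤ) - e t) ?_ ?_
    · ext t
      have := congrFun this t
      simp at this
      omega
    · simp only [mul_sub, Finset.sum_sub_distrib]
      rw [sub_eq_zero]
      exact_mod_cast h1
    · simp only [zpow_sub₀ (hν _), Finset.prod_div_distrib, zpow_natCast]
      rw [h2, div_self]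
      exact Finset.prod_ne_zero_iff.2 fun t _ => pow_ne_zero _ (hν t)
  · intro n
    rw [← hG n, MvPolynomial.eval_eq']
    refine Finset.sum_congr rfl fun d _ => ?_
    simp only [mul_pow, Finset.prod_mul_distrib, ← pow_mul, Finset.prod_pow_eq_pow_sum, mul_comm n,
      ← Finset.prod_pow]
    ring

theorem aux_perm {𝕜 : Type*} [Field 𝕜] {k : ℕ} (f g : Fin k → 𝕜)
    (h : ∏ i, (Polynomial.X - Polynomial.C (f i)) = ∏ i, (Polynomial.X - Polynomial.C (g i))) :
    ∃ σ : Equiv.Perm (Fin k), ∀ i, g (σ i) = f i := by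
  classical
  have h1 : Multiset.map f Finset.univ.val = Multiset.map g Finset.univ.val := by
    have := congrArg Polynomial.roots h
    have e : ∀ f : Fin k → 𝕜, ∏ i, (Polynomial.X - Polynomial.C (f i))
      = ((Multiset.map f Finset.univ.val).map (fun a => Polynomial.X - Polynomial.C a)).prod := by
        intro f; rw [Multiset.map_map]; rfl
    rwa [e, e, Polynomial.roots_multiset_prod_X_sub_C, Polynomial.roots_multiset_prod_X_sub_C] at this
  have h2 : ∀ y, Nonempty ({i // f i = y} ≃ {i // g i = y}) := by
    intro y
    have := congrArg (Multiset.count y) h1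
    rw [Multiset.count_map, Multiset.count_map] at this
    refine Fintype.card_eq.1 ?_
    rw [Fintype.card_subtype, Fintype.card_subtype]
    simpa [Finset.card, eq_comm] using this
  let e := fun y => (h2 y).some
  refine ⟨(Equiv.sigmaFiberEquiv f).symm.trans ((Equiv.sigmaCongrRight e).trans (Equiv.sigmaFiberEquiv g)), fun i => ?_⟩
  exact (e (f i) ⟨i, rfl⟩).2

/-- Precomposition of a polynomial with a matrix. -/
noncomputable def auxComp {𝕜 : Type*} [Field 𝕜] {k : ℕ} (M : Matrix (Fin k) (Fin k) 𝕜)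
    (F : MvPolynomial (Fin k) 𝕜) : MvPolynomial (Fin k) 𝕜 :=
  bind₁ (fun i => ∑ j, C (M i j) * X j) F

theorem auxComp_eval {𝕜 : Type*} [Field 𝕜] {k : ℕ} (M : Matrix (Fin k) (Fin k) 𝕜)
    (F : MvPolynomial (Fin k) 𝕜) (x : Fin k → 𝕜) :
    eval x (auxComp M F) = eval (M.mulVec x) F := by
  unfold auxComp
  rw [← MvPolynomial.aeval_eq_eval, MvPolynomial.aeval_bind₁]
  simp [MvPolynomial.aeval_eq_eval]
  rfl

theorem auxComp_ne {𝕜 : Type*} [Field 𝕜] [CharZero 𝕜] {k : ℕ} (M : Matrix (Fin k) (Fin k) 𝕜)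
    (hM : IsUnit M.det) (F : MvPolynomial (Fin k) 𝕜) (hF : F ≠ 0) : auxComp M F ≠ 0 := by
  intro h
  apply hF
  apply MvPolynomial.funext
  intro y
  have := auxComp_eval M F (M⁻¹.mulVec y)
  rw [h, Matrix.mulVec_mulVec, Matrix.mul_nonsing_inv _ hM, Matrix.one_mulVec] at this
  simpa using this.symm

/-- (i) implies (ii) -/
theorem aux_i_ii {𝕜 : Type*} [Field 𝕜] [CharZero 𝕜] {k : ℕ}
    (A : Matrix (Fin k) (Fin k) 𝕜) (hA : A.det ≠ 0)
    (h : ∃ p q : MvPolynomial (Fin k) 𝕜, q ≠ 0 ∧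
        (¬ ∃ a : 𝕜, ∀ x : Fin k → 𝕜, eval x q ≠ 0 → eval x p = a * eval x q) ∧
        ∀ x : Fin k → 𝕜,
          eval (A.mulVec x) p * eval x q = eval x p * eval (A.mulVec x) q) :
    ∀ α : Fin k → 𝕜, ∃ F : MvPolynomial (Fin k) 𝕜, F ≠ 0 ∧
        ∀ n : ℕ, eval ((A ^ n).mulVec α) F = 0 := by
  obtain ⟨p, q, hq, hnc, hinv⟩ := h
  have hdet : ∀ n, IsUnit (A ^ n).det := fun n => by
    rw [Matrix.det_pow]; exact (isUnit_iff_ne_zero.2 hA).pow n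
  have hpoly : ∀ n, auxComp (A ^ n) p * q = p * auxComp (A ^ n) q := by
    intro n
    induction n with
    | zero =>
      apply MvPolynomial.funext
      intro x
      simp [auxComp_eval]
    | succ n ih =>
      have h1 : auxComp (A ^ (n+1)) p * auxComp (A ^ n) q
          = auxComp (A ^ n) p * auxComp (A ^ (n+1)) q := by
        apply MvPolynomial.funext
        intro x
        have := hinv ((A ^ n).mulVec x)
        rw [Matrix.mulVec_mulVec, ← pow_succ'] at this
        simpa [auxComp_eval] using this
      apply mul_right_cancel₀ (auxComp_ne (A ^ n) (hdet n) q hq)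
      linear_combination q * h1 + auxComp (A ^ (n+1)) q * ih
  intro α
  by_cases hall : ∀ n : ℕ, eval ((A ^ n).mulVec α) p = 0 ∧ eval ((A ^ n).mulVec α) q = 0
  · exact ⟨q, hq, fun n => (hall n).2⟩
  · push Not at hall
    obtain ⟨m, hm⟩ := hall
    set β := (A ^ m).mulVec α
    have hne : C (eval β q) * p - C (eval β p) * q ≠ 0 := by
      intro h0
      have hx : ∀ x, eval β q * eval x p = eval β p * eval x q := by
        intro x
        have := congrArg (eval x) h0
        simpa [sub_eq_zero] using this
      by_cases hb : eval β q = 0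
      · have hp : eval β p ≠ 0 := fun h => hm h hb
        apply hq
        apply MvPolynomial.funext
        intro x
        have := hx x
        rw [hb, zero_mul] at this
        simpa [hp] using this.symm
      · apply hnc
        refine ⟨eval β p / eval β q, fun x _ => ?_⟩
        have := hx x
        field_simp
        linear_combination this
    refine ⟨auxComp (A ^ m) _, auxComp_ne _ (hdet m) _ hne, fun n => ?_⟩
    have := congrArg (eval β) (hpoly n)
    simp only [map_mul, auxComp_eval] at this
    have e : (A ^ m).mulVec ((A ^ n).mulVec α) = (A ^ n).mulVec β := by
      simp only [β, Matrix.mulVec_mulVec, ← pow_add, add_comm]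
    rw [auxComp_eval, e]
    simp
    linear_combination this

/-- A quotient of an orbit description through a change of basis. -/
theorem aux_orbit {𝕜 : Type*} [Field 𝕜] [CharZero 𝕜] {k : ℕ}
    (A P : Matrix (Fin k) (Fin k) 𝕜) (hP : IsUnit P.det) (x : ℕ → Fin k → 𝕜)
    (hx : ∀ n, A.mulVec (P.mulVec (x n)) = P.mulVec (x (n + 1)))
    (hd : ∀ G : MvPolynomial (Fin k) 𝕜, (∀ n, eval (x n) G = 0) → G = 0) :
    ¬ (∀ α : Fin k → 𝕜, ∃ F : MvPolynomial (Fin k) 𝕜, F ≠ 0 ∧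
        ∀ n : ℕ, eval ((A ^ n).mulVec α) F = 0) := by
  intro h
  obtain ⟨F, hF, hF0⟩ := h (P.mulVec (x 0))
  have e : ∀ n, (A ^ n).mulVec (P.mulVec (x 0)) = P.mulVec (x n) := by
    intro n
    induction n with
    | zero => simp
    | succ n ih => rw [pow_succ', ← Matrix.mulVec_mulVec, ih, hx]
  apply auxComp_ne P hP F hF
  apply hd
  intro n
  rw [auxComp_eval, ← e, hF0]

/-- linear form -/
noncomputable def auxL {𝕜 : Type*} [Field 𝕜] {k : ℕ} (w : Fin k → 𝕜) : MvPolynomial (Fin k) 𝕜 :=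
  ∑ j, C (w j) * X j

theorem auxL_eval {𝕜 : Type*} [Field 𝕜] {k : ℕ} (w x : Fin k → 𝕜) :
    eval x (auxL w) = w ⬝ᵥ x := by
  simp [auxL, dotProduct]

theorem aux_dual {𝕜 : Type*} [Field 𝕜] {k : ℕ} (f : (Fin k → 𝕜) →ₗ[𝕜] 𝕜) :
    ∃ x : Fin k → 𝕜, ∀ w, w ⬝ᵥ x = f w := by
  refine ⟨fun i => f (fun j => if i = j then 1 else 0), fun w => ?_⟩
  rw [LinearMap.pi_apply_eq_sum_univ f w]
  rfl

theorem aux_mono {𝕜 : Type*} [Field 𝕜] [CharZero 𝕜] {k m : ℕ}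
    (A : Matrix (Fin k) (Fin k) 𝕜) (w : Fin m → Fin k → 𝕜) (hw : LinearIndependent 𝕜 w)
    (ν : Fin m → 𝕜) (hν : ∀ i, ν i ≠ 0) (hwA : ∀ i, Matrix.vecMul (w i) A = ν i • w i)
    (c : Fin m → ℤ) (hc : c ≠ 0) (hprod : ∏ i, ν i ^ c i = 1) :
    ∃ p q : MvPolynomial (Fin k) 𝕜, q ≠ 0 ∧
        (¬ ∃ a : 𝕜, ∀ x : Fin k → 𝕜, eval x q ≠ 0 → eval x p = a * eval x q) ∧
        ∀ x : Fin k → 𝕜,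
          eval (A.mulVec x) p * eval x q = eval x p * eval (A.mulVec x) q := by
  classical
  have hsurj : ∀ y : Fin m → 𝕜, ∃ x, ∀ i, w i ⬝ᵥ x = y i := by
    intro y
    obtain ⟨f, hf⟩ := LinearMap.exists_extend ((Finsupp.linearCombination 𝕜 y).comp hw.repr)
    obtain ⟨x, hx⟩ := aux_dual f
    refine ⟨x, fun i => ?_⟩
    rw [hx]
    have := LinearMap.congr_fun hf ⟨w i, Submodule.subset_span ⟨i, rfl⟩⟩
    simp only [LinearMap.comp_apply, Submodule.subtype_apply] at this
    rw [this]
    have := hw.repr_eq_single i ⟨w i, Submodule.subset_span ⟨i, rfl⟩⟩ rfl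
    simp [this]
  let p : MvPolynomial (Fin k) 𝕜 := ∏ i, auxL (w i) ^ (c i).toNat
  let q : MvPolynomial (Fin k) 𝕜 := ∏ i, auxL (w i) ^ (-c i).toNat
  have ep : ∀ x, eval x p = ∏ i, (w i ⬝ᵥ x) ^ (c i).toNat := fun x => by
    simp [p, map_prod, auxL_eval]
  have eq : ∀ x, eval x q = ∏ i, (w i ⬝ᵥ x) ^ (-c i).toNat := fun x => by
    simp [q, map_prod, auxL_eval]
  have hz : ∀ (z : 𝕜) (n : ℤ), z ≠ 0 → z ^ n.toNat = z ^ n * z ^ (-n).toNat := by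
    intro z n h
    rw [← zpow_natCast, ← zpow_natCast, ← zpow_add₀ h]
    congr 1
    omega
  have hpr : ∏ i, ν i ^ (c i).toNat = ∏ i, ν i ^ (-c i).toNat := by
    rw [Finset.prod_congr rfl fun i _ => hz (ν i) (c i) (hν i), Finset.prod_mul_distrib, hprod,
      one_mul]
  obtain ⟨x1, hx1⟩ := hsurj (fun _ => 1)
  refine ⟨p, q, ?_, ?_, ?_⟩
  · intro h
    have := eq x1
    rw [h] at this
    simp [hx1] at this
  · rintro ⟨a, ha⟩
    obtain ⟨i, hi⟩ := Function.ne_iff.1 hc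
    have h1 := ha x1
    rw [ep, eq] at h1
    simp [hx1] at h1
    obtain ⟨x2, hx2⟩ := hsurj (Function.update (fun _ => 1) i 2)
    have h2 := ha x2
    rw [ep, eq, ← h1, one_mul] at h2
    simp only [hx2] at h2
    have hh : ∀ e : Fin m → ℕ, ∏ j, (Function.update (fun _ => (1 : 𝕜)) i 2 j) ^ e j = 2 ^ e i := by
      intro e
      rw [Finset.prod_eq_single i]
      · simp
      · intro j _ hj; simp [hj]
      · simp
    rw [hh, hh] at h2
    have h3 := h2 (pow_ne_zero _ two_ne_zero)
    have h4 : (2 : ℕ) ^ (c i).toNat = 2 ^ (-c i).toNat := by exact_mod_cast h3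
    have h5 := Nat.pow_right_injective le_rfl h4
    simp at hi
    omega
  · intro x
    rw [ep, ep, eq, eq]
    simp only [Matrix.dotProduct_mulVec, hwA, smul_dotProduct, smul_eq_mul, mul_pow,
      Finset.prod_mul_distrib, hpr]
    ring

theorem aux_L0 {𝕜 V : Type*} [Field 𝕜] [IsAlgClosed 𝕜] [AddCommGroup V] [Module 𝕜 V]
    [FiniteDimensional 𝕜 V] (T : V →ₗ[𝕜] V) (N : Submodule 𝕜 V) (hN : ∀ x ∈ N, T x ∈ N)
    (hne : N ≠ ⊤) : ∃ w, w ∉ N ∧ ∃ μ : 𝕜, T w - μ • w ∈ N := by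
  have : Nontrivial (V ⧸ N) := Submodule.Quotient.nontrivial_iff.2 hne
  obtain ⟨μ, hμ⟩ := Module.End.exists_eigenvalue (N.mapQ N T hN : Module.End 𝕜 (V ⧸ N))
  obtain ⟨v, hv⟩ := hμ.exists_hasEigenvector
  obtain ⟨w, rfl⟩ := N.mkQ_surjective v
  refine ⟨w, ?_, μ, ?_⟩
  · intro hw
    exact hv.2 (by simpa using hw)
  · have := hv.apply_eq_smul
    rw [← Submodule.Quotient.mk_eq_zero, Submodule.Quotient.mk_sub, Submodule.Quotient.mk_smul,
      sub_eq_zero]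
    simpa using this

theorem aux_L1 {𝕜 V : Type*} [Field 𝕜] [AddCommGroup V] [Module 𝕜 V]
    (T : V →ₗ[𝕜] V) (E : Set V) (hE : ∀ v ∈ E, ∃ μ : 𝕜, T v = μ • v) (l : 𝕜)
    (t : V) (ht : t ∈ Submodule.span 𝕜 E) :
    ∃ u ∈ Submodule.span 𝕜 E, ∃ r ∈ Submodule.span 𝕜 E, T r = l • r ∧ t + (T u - l • u) = r := by
  induction ht using Submodule.span_induction with
  | mem v hv =>
    obtain ⟨μ, hμ⟩ := hE v hv
    by_cases h : μ = l
    · exact ⟨0, zero_mem _, v, Submodule.subset_span hv, h ▸ hμ, by simp⟩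
    · refine ⟨-((μ - l)⁻¹ • v), neg_mem (Submodule.smul_mem _ _ (Submodule.subset_span hv)), 0,
        zero_mem _, by simp, ?_⟩
      have h' : μ - l ≠ 0 := sub_ne_zero.2 h
      rw [map_neg, map_smul, hμ]
      have : (μ - l)⁻¹ • μ • v - l • (μ - l)⁻¹ • v = v := by
        rw [smul_smul, smul_smul, ← sub_smul]
        have : (μ - l)⁻¹ * μ - l * (μ - l)⁻¹ = 1 := by field_simp
        rw [this, one_smul]
      rw [smul_neg, ← neg_sub', this, add_neg_cancel]
  | zero => exact ⟨0, zero_mem _, 0, zero_mem _, by simp, by simp⟩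
  | add x y _ _ hx hy =>
    obtain ⟨u, hu, r, hr, h1, h2⟩ := hx
    obtain ⟨u', hu', r', hr', h1', h2'⟩ := hy
    refine ⟨u + u', add_mem hu hu', r + r', add_mem hr hr', by rw [map_add, h1, h1', smul_add], ?_⟩
    rw [map_add, smul_add, ← h2, ← h2']
    abel
  | smul a x _ hx =>
    obtain ⟨u, hu, r, hr, h1, h2⟩ := hx
    refine ⟨a • u, Submodule.smul_mem _ _ hu, a • r, Submodule.smul_mem _ _ hr,
      by rw [map_smul, h1, smul_comm], ?_⟩
    rw [map_smul, smul_comm l a u, ← h2, smul_add, smul_sub]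

theorem auxL_ne {𝕜 : Type*} [Field 𝕜] {k : ℕ} (w : Fin k → 𝕜) (hw : w ≠ 0) : auxL w ≠ 0 := by
  intro h
  apply hw
  funext i
  have := auxL_eval w (Pi.single i 1)
  rw [h] at this
  simpa using this.symm

theorem aux_exists_eval {𝕜 : Type*} [Field 𝕜] [CharZero 𝕜] {k : ℕ} (q : MvPolynomial (Fin k) 𝕜)
    (hq : q ≠ 0) : ∃ x, eval x q ≠ 0 := by
  by_contra h
  push Not at h
  exact hq (MvPolynomial.funext fun x => by simpa using h x)

theorem aux_chain2 {𝕜 : Type*} [Field 𝕜] [CharZero 𝕜] {k : ℕ}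
    (A : Matrix (Fin k) (Fin k) 𝕜) (s s' z w v : Fin k → 𝕜) (l μ : 𝕜) (hμ : μ ≠ 0)
    (hs : s ≠ 0) (hs' : s' ≠ 0) (h1 : Matrix.vecMul s A = l • s)
    (h2 : Matrix.vecMul s' A = μ • s') (h3 : Matrix.vecMul z A = l • z + s)
    (h4 : Matrix.vecMul w A = μ • w + s') (v1 : s ⬝ᵥ v = 0) (v2 : s' ⬝ᵥ v = 0)
    (v3 : z ⬝ᵥ v = 0) (v4 : w ⬝ᵥ v ≠ 0) :
    ∃ p q : MvPolynomial (Fin k) 𝕜, q ≠ 0 ∧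
        (¬ ∃ a : 𝕜, ∀ x : Fin k → 𝕜, eval x q ≠ 0 → eval x p = a * eval x q) ∧
        ∀ x : Fin k → 𝕜,
          eval (A.mulVec x) p * eval x q = eval x p * eval (A.mulVec x) q := by
  have hq : auxL s * auxL s' ≠ 0 := mul_ne_zero (auxL_ne s hs) (auxL_ne s' hs')
  refine ⟨C μ * auxL w * auxL s - C l * auxL z * auxL s', auxL s * auxL s', hq, ?_, ?_⟩
  · rintro ⟨a, ha⟩
    obtain ⟨x, hx⟩ := aux_exists_eval _ hq
    have e1 := ha x hx
    have e2 := ha (x + v)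
    simp only [map_mul, map_sub, auxL_eval, eval_C, dotProduct_add, v1, v2, v3, add_zero] at e1 e2 hx
    have e3 := e2 hx
    have : μ * (w ⬝ᵥ v) * (s ⬝ᵥ x) = 0 := by linear_combination e3 - e1
    simp [hμ, v4] at this
    simp [this] at hx
  · intro x
    simp only [map_mul, map_sub, auxL_eval, eval_C, Matrix.dotProduct_mulVec, h1, h2, h3, h4,
      add_dotProduct, smul_dotProduct, smul_eq_mul]
    ring

theorem aux_chain3 {𝕜 : Type*} [Field 𝕜] [CharZero 𝕜] {k : ℕ}
    (A : Matrix (Fin k) (Fin k) 𝕜) (s z w v : Fin k → 𝕜) (l : 𝕜) (hl : l ≠ 0)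
    (hs : s ≠ 0) (h1 : Matrix.vecMul s A = l • s)
    (h3 : Matrix.vecMul z A = l • z + s)
    (h4 : Matrix.vecMul w A = l • w + z) (v1 : s ⬝ᵥ v = 0)
    (v3 : z ⬝ᵥ v = 0) (v4 : w ⬝ᵥ v ≠ 0) :
    ∃ p q : MvPolynomial (Fin k) 𝕜, q ≠ 0 ∧
        (¬ ∃ a : 𝕜, ∀ x : Fin k → 𝕜, eval x q ≠ 0 → eval x p = a * eval x q) ∧
        ∀ x : Fin k → 𝕜,
          eval (A.mulVec x) p * eval x q = eval x p * eval (A.mulVec x) q := by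
  have hq : auxL s * auxL s ≠ 0 := mul_ne_zero (auxL_ne s hs) (auxL_ne s hs)
  refine ⟨C l * auxL z * auxL z - C (2 * l) * auxL w * auxL s - auxL z * auxL s,
    auxL s * auxL s, hq, ?_, ?_⟩
  · rintro ⟨a, ha⟩
    obtain ⟨x, hx⟩ := aux_exists_eval _ hq
    have e1 := ha x hx
    have e2 := ha (x + v)
    simp only [map_mul, map_sub, auxL_eval, eval_C, dotProduct_add, v1, v3, add_zero] at e1 e2 hx
    have e3 := e2 hx
    have : (2 * l) * (w ⬝ᵥ v) * (s ⬝ᵥ x) = 0 := by linear_combination e1 - e3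
    simp [hl, v4] at this
    simp [this] at hx
  · intro x
    simp only [map_mul, map_sub, auxL_eval, eval_C, Matrix.dotProduct_mulVec, h1, h3, h4,
      add_dotProduct, smul_dotProduct, smul_eq_mul]
    ring

theorem aux_defect {𝕜 : Type*} [Field 𝕜] [IsAlgClosed 𝕜] [CharZero 𝕜] {k : ℕ}
    (A : Matrix (Fin k) (Fin k) 𝕜) (hA : A.det ≠ 0)
    (hS : Module.finrank 𝕜 (Submodule.span 𝕜 {v : Fin k → 𝕜 | ∃ μ : 𝕜, Matrix.vecMul v A = μ • v})
      + 1 < k) :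
    ∃ p q : MvPolynomial (Fin k) 𝕜, q ≠ 0 ∧
        (¬ ∃ a : 𝕜, ∀ x : Fin k → 𝕜, eval x q ≠ 0 → eval x p = a * eval x q) ∧
        ∀ x : Fin k → 𝕜,
          eval (A.mulVec x) p * eval x q = eval x p * eval (A.mulVec x) q := by
  set E : Set (Fin k → 𝕜) := {v : Fin k → 𝕜 | ∃ μ : 𝕜, Matrix.vecMul v A = μ • v} with hEdef
  set S := Submodule.span 𝕜 E with hSdef
  let T : (Fin k → 𝕜) →ₗ[𝕜] (Fin k → 𝕜) := A.vecMulLinear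
  have hT : ∀ v, T v = Matrix.vecMul v A := fun v => rfl
  have hE : ∀ v ∈ E, ∃ μ : 𝕜, T v = μ • v := fun v hv => hv
  have hmemE : ∀ v (μ : 𝕜), T v = μ • v → v ∈ S := fun v μ h => Submodule.subset_span ⟨μ, h⟩
  have hSinv : ∀ x ∈ S, T x ∈ S := by
    intro x hx
    have : S ≤ S.comap T := by
      rw [hSdef, Submodule.span_le]
      rintro v ⟨μ, hv⟩
      show T v ∈ S
      rw [hT, hv]
      exact Submodule.smul_mem _ _ (Submodule.subset_span ⟨μ, hv⟩)
    exact this hx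
  have hSne : S ≠ ⊤ := by
    intro h
    rw [h, finrank_top, Module.finrank_fin_fun] at hS
    omega
  have hnz : ∀ (w : Fin k → 𝕜) (μ : 𝕜), w ≠ 0 → T w = μ • w → μ ≠ 0 := by
    rintro w μ hw h rfl
    rw [zero_smul] at h
    exact hw (Matrix.eq_zero_of_vecMul_eq_zero hA h)
  obtain ⟨z0, hz0, l, hl⟩ := aux_L0 T S hSinv hSne
  obtain ⟨u, hu, r, hrS, hr, hur⟩ := aux_L1 T E hE l _ hl
  obtain ⟨z, hzdef⟩ : ∃ z, z = z0 + u := ⟨_, rfl⟩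
  have hz : z ∉ S := fun h => hz0 (by
    have := sub_mem h hu
    rwa [hzdef, add_sub_cancel_right] at this)
  have hTz : T z = l • z + r := by
    rw [hzdef, ← hur, map_add, smul_add]; abel
  have hr0 : r ≠ 0 := by
    rintro rfl
    exact hz (hmemE z l (by rw [hTz, add_zero]))
  have hl0 : l ≠ 0 := hnz r l hr0 hr
  obtain ⟨S1, hS1⟩ : ∃ S1, S1 = S ⊔ Submodule.span 𝕜 {z} := ⟨_, rfl⟩
  have hSS1 : S ≤ S1 := hS1 ▸ le_sup_left
  have hzS1 : z ∈ S1 := hS1 ▸ (le_sup_right (a := S) (Submodule.mem_span_singleton_self z))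
  have hS1inv : ∀ x ∈ S1, T x ∈ S1 := by
    intro x hx
    rw [hS1, Submodule.mem_sup] at hx
    obtain ⟨y, hy, y', hy', rfl⟩ := hx
    obtain ⟨c, rfl⟩ := Submodule.mem_span_singleton.1 hy'
    rw [map_add, map_smul, hTz]
    exact add_mem (hSS1 (hSinv y hy)) (Submodule.smul_mem _ _
      (add_mem (Submodule.smul_mem _ _ hzS1) (hSS1 hrS)))
  have hS1ne : S1 ≠ ⊤ := by
    intro h
    have h1 := Submodule.finrank_add_le_finrank_add_finrank S (Submodule.span 𝕜 {z})
    rw [← hS1, h, finrank_top, Module.finrank_fin_fun] at h1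
    have h2 : Module.finrank 𝕜 (Submodule.span 𝕜 {z}) ≤ 1 := by
      simpa using finrank_span_le_card (R := 𝕜) ({z} : Set (Fin k → 𝕜))
    omega
  have hfun : ∀ w, w ∉ S1 → ∃ v : Fin k → 𝕜, w ⬝ᵥ v ≠ 0 ∧ ∀ y ∈ S1, y ⬝ᵥ v = 0 := by
    intro w hw
    obtain ⟨f, hf, hf2⟩ := Submodule.exists_le_ker_of_notMem hw
    obtain ⟨v, hv⟩ := aux_dual f
    exact ⟨v, by rwa [hv], fun y hy => by rw [hv]; exact hf2 hy⟩
  have case1 : ∀ w, w ∉ S1 → ∀ μ : 𝕜, T w - μ • w ∈ S → 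
    ∃ p q : MvPolynomial (Fin k) 𝕜, q ≠ 0 ∧
        (¬ ∃ a : 𝕜, ∀ x : Fin k → 𝕜, eval x q ≠ 0 → eval x p = a * eval x q) ∧
        ∀ x : Fin k → 𝕜,
          eval (A.mulVec x) p * eval x q = eval x p * eval (A.mulVec x) q := by
    intro w hw μ hμ
    obtain ⟨u', hu', r', hrS', hr', hur'⟩ := aux_L1 T E hE μ _ hμ
    have hw1 : w + u' ∉ S1 := fun h => hw (by
      have := sub_mem h (hSS1 hu')
      rwa [add_sub_cancel_right] at this)
    have hTw : T (w + u') = μ • (w + u') + r' := by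
      rw [← hur', map_add, smul_add]; abel
    have hr0' : r' ≠ 0 := by
      rintro rfl
      exact hw1 (hSS1 (hmemE _ μ (by rw [hTw, add_zero])))
    obtain ⟨v, hv1, hv2⟩ := hfun _ hw1
    exact aux_chain2 A r r' z (w + u') v l μ (hnz r' μ hr0' hr') hr0 hr0' hr hr' hTz hTw
      (hv2 _ (hSS1 hrS)) (hv2 _ (hSS1 hrS')) (hv2 _ hzS1) hv1
  obtain ⟨w, hw, μ, hμ⟩ := aux_L0 T S1 hS1inv hS1ne
  have hμ' := hμ
  rw [hS1, Submodule.mem_sup] at hμ'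
  obtain ⟨t, ht, y', hy', hty⟩ := hμ'
  obtain ⟨c, rfl⟩ := Submodule.mem_span_singleton.1 hy'
  by_cases hc : c = 0
  · refine case1 w hw μ ?_
    rw [← hty, hc, zero_smul, add_zero]
    exact ht
  by_cases hlm : μ = l
  · subst hlm
    obtain ⟨u', hu', r', hrS', hr', hur'⟩ := aux_L1 T E hE μ _ ht
    have hw1 : w + u' ∉ S1 := fun h => hw (by
      have := sub_mem h (hSS1 hu')
      rwa [add_sub_cancel_right] at this)
    have hTw : T (w + u') = μ • (w + u') + (c • z + r') := by
      rw [← hur', map_add, smul_add]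
      have : T w = μ • w + (t + c • z) := by rw [hty]; abel
      rw [this]; abel
    have hTz2 : T (c • z + r') = μ • (c • z + r') + c • r := by
      rw [map_add, map_smul, hTz, hr', smul_add, smul_add, smul_comm]; abel
    obtain ⟨v, hv1, hv2⟩ := hfun _ hw1
    exact aux_chain3 A (c • r) (c • z + r') (w + u') v μ hl0 (smul_ne_zero hc hr0)
      (by rw [← hT, map_smul, hr, smul_comm]) hTz2 hTw
      (hv2 _ (Submodule.smul_mem _ _ (hSS1 hrS)))
      (hv2 _ (add_mem (Submodule.smul_mem _ _ hzS1) (hSS1 hrS'))) hv1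
  · have hml : μ - l ≠ 0 := sub_ne_zero.2 hlm
    refine case1 (w + (c / (μ - l)) • z) ?_ μ ?_
    · intro h
      apply hw
      have := sub_mem h (Submodule.smul_mem S1 (c / (μ - l)) hzS1)
      rwa [add_sub_cancel_right] at this
    · have : T (w + (c / (μ - l)) • z) - μ • (w + (c / (μ - l)) • z) = t + (c / (μ - l)) • r := by
        have h1 : T w = μ • w + (t + c • z) := by rw [hty]; abel
        rw [map_add, map_smul, hTz, h1]
        have h2 : c • z = (c / (μ - l)) • (μ - l) • z := by
          rw [smul_smul, div_mul_cancel₀ _ hml]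
        rw [h2]
        module
      rw [this]
      exact add_mem ht (Submodule.smul_mem _ _ hrS)

theorem aux_unit {𝕜 : Type*} [Field 𝕜] {k : ℕ} (b : Fin k → Fin k → 𝕜)
    (hb : LinearIndependent 𝕜 b) : IsUnit (Matrix.of b) :=
  Matrix.linearIndependent_rows_iff_isUnit.1 hb

theorem aux_eig {𝕜 : Type*} [Field 𝕜] [IsAlgClosed 𝕜] {m : ℕ}
    (A : Matrix (Fin (m + 1)) (Fin (m + 1)) 𝕜) (lam : Fin (m + 1) → 𝕜)
    (hlam : A.charpoly = ∏ i, (Polynomial.X - Polynomial.C (lam i)))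
    (w : Fin m → Fin (m + 1) → 𝕜) (hw : LinearIndependent 𝕜 w)
    (ν : Fin m → 𝕜) (hwA : ∀ i, Matrix.vecMul (w i) A = ν i • w i) :
    ∃ ι : Fin m → Fin (m + 1), Function.Injective ι ∧ ∀ i, lam (ι i) = ν i := by
  let T : (Fin (m + 1) → 𝕜) →ₗ[𝕜] (Fin (m + 1) → 𝕜) := A.vecMulLinear
  have hT : ∀ v, T v = Matrix.vecMul v A := fun v => rfl
  obtain ⟨N, hN⟩ : ∃ N, N = Submodule.span 𝕜 (Set.range w) := ⟨_, rfl⟩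
  have hNinv : ∀ x ∈ N, T x ∈ N := by
    intro x hx
    have : N ≤ N.comap T := by
      conv_lhs => rw [hN]
      rw [Submodule.span_le]
      rintro _ ⟨i, rfl⟩
      show T (w i) ∈ N
      rw [hT, hwA, hN]
      exact Submodule.smul_mem _ _ (Submodule.subset_span ⟨i, rfl⟩)
    exact this hx
  have hNne : N ≠ ⊤ := by
    intro h
    have h1 := finrank_span_eq_card hw
    rw [← hN, h, finrank_top, Module.finrank_fin_fun, Fintype.card_fin] at h1
    omega
  obtain ⟨z, hz, l, hl⟩ := aux_L0 T N hNinv hNne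
  rw [hN] at hz hl
  obtain ⟨s, hs⟩ := (Submodule.mem_span_range_iff_exists_fun 𝕜).1 hl
  let b : Fin (m + 1) → Fin (m + 1) → 𝕜 := Fin.cons z w
  have hb : LinearIndependent 𝕜 b := linearIndependent_finCons.2 ⟨hw, hz⟩
  have hP := aux_unit b hb
  let J : Matrix (Fin (m + 1)) (Fin (m + 1)) 𝕜 :=
    Matrix.of (Fin.cons (Fin.cons l s) (fun i => Pi.single i.succ (ν i)))
  have hPA : Matrix.of b * A = J * Matrix.of b := by
    ext i j
    rw [← Matrix.row_apply (Matrix.of b * A), ← Matrix.row_apply (J * Matrix.of b)]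
    refine congrFun ?_ j
    have e1 : (Matrix.of b * A).row i = Matrix.vecMul (b i) A := rfl
    have e2 : (J * Matrix.of b).row i = Matrix.vecMul (J i) (Matrix.of b) := rfl
    rw [e1, e2, Matrix.vecMul_eq_sum, ← Matrix.vecMul_eq_sum, Matrix.vecMul_eq_sum (J i)]
    refine Fin.cases ?_ (fun i => ?_) i
    · have : Matrix.vecMul z A = l • z + ∑ i, s i • w i := by
        rw [hs, ← hT]; abel
      rw [Fin.sum_univ_succ]
      exact this
    · rw [Finset.sum_eq_single i.succ]
      · have e3 : J i.succ i.succ = ν i := by simp [J]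
        rw [e3]
        exact hwA i
      · intro j _ hj
        simp [J, hj]
      · simp
  have hchar : A.charpoly = J.charpoly := by
    obtain ⟨U, hU⟩ := hP
    have : A = U⁻¹.val * J * U.val := by
      rw [mul_assoc, hU, ← hPA, ← hU, ← mul_assoc, Units.inv_mul, one_mul]
    rw [this, Matrix.coe_units_inv, Matrix.charpoly_units_conj']
  have hJ : J.IsUpperTriangular := by
    intro i j hij
    revert hij
    refine Fin.cases ?_ (fun i => ?_) i
    · intro h; exact absurd h (by simp)
    · intro h
      have : j ≠ i.succ := ne_of_lt h
      simp [J, this]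
  rw [Matrix.charpoly_of_isUpperTriangular J hJ, hlam] at hchar
  obtain ⟨σ, hσ⟩ := aux_perm _ _ hchar.symm
  refine ⟨fun i => σ i.succ, fun i j h => Fin.succ_injective _ (σ.injective h), fun i => ?_⟩
  rw [hσ]
  simp [J]

theorem aux_diag_of_basis {𝕜 : Type*} [Field 𝕜] {k : ℕ}
    (A : Matrix (Fin k) (Fin k) 𝕜) (b : Fin k → Fin k → 𝕜) (hb : LinearIndependent 𝕜 b)
    (ν : Fin k → 𝕜) (h : ∀ i, A.mulVec (b i) = ν i • b i) :
    ∃ P : Matrix (Fin k) (Fin k) 𝕜, IsUnit P.det ∧ A = P * Matrix.diagonal ν * P⁻¹ := by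
  have hu : IsUnit (Matrix.of b).transpose.det := by
    rw [Matrix.det_transpose]
    exact (Matrix.isUnit_iff_isUnit_det _).1 (aux_unit b hb)
  refine ⟨(Matrix.of b).transpose, hu, ?_⟩
  have : A * (Matrix.of b).transpose = (Matrix.of b).transpose * Matrix.diagonal ν := by
    ext i j
    rw [Matrix.mul_diagonal]
    have := congrFun (h j) i
    simp only [Pi.smul_apply, smul_eq_mul] at this
    rw [Matrix.transpose_apply, Matrix.of_apply, mul_comm, ← this]
    rfl
  rw [← this, Matrix.mul_assoc, Matrix.mul_nonsing_inv _ hu, Matrix.mul_one]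

theorem aux_lam_ne {𝕜 : Type*} [Field 𝕜] {k : ℕ}
    (A : Matrix (Fin k) (Fin k) 𝕜) (hA : A.det ≠ 0) (lam : Fin k → 𝕜)
    (hlam : A.charpoly = ∏ i, (Polynomial.X - Polynomial.C (lam i))) (i : Fin k) :
    lam i ≠ 0 ∧ ∃ e : Fin k → 𝕜, e ≠ 0 ∧ A.mulVec e = lam i • e := by
  have h1 : (Matrix.scalar (Fin k) (lam i) - A).det = 0 := by
    rw [← Matrix.eval_charpoly, hlam, Polynomial.eval_prod]
    exact Finset.prod_eq_zero (Finset.mem_univ i) (by simp)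
  obtain ⟨e, he, he2⟩ := Matrix.exists_mulVec_eq_zero_iff.2 h1
  have h2 : A.mulVec e = lam i • e := by
    rw [Matrix.sub_mulVec, sub_eq_zero] at he2
    rw [← he2]
    ext j
    simp [Matrix.scalar_apply, Matrix.mulVec_diagonal]
  refine ⟨fun h => ?_, e, he, h2⟩
  rw [h, zero_smul] at h2
  exact he (Matrix.eq_zero_of_mulVec_eq_zero hA h2)

theorem aux_nondiag {𝕜 : Type*} [Field 𝕜] [IsAlgClosed 𝕜] [CharZero 𝕜] {m : ℕ}
    (A : Matrix (Fin (m + 1)) (Fin (m + 1)) 𝕜) (hA : A.det ≠ 0) (lam : Fin (m + 1) → 𝕜)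
    (hlam : A.charpoly = ∏ i, (Polynomial.X - Polynomial.C (lam i)))
    (hnd : ¬ ∃ P : Matrix (Fin (m + 1)) (Fin (m + 1)) 𝕜, IsUnit P.det ∧
      A = P * Matrix.diagonal lam * P⁻¹)
    (ι : Fin m → Fin (m + 1)) (hι : ∀ c : Fin m → ℤ, ∏ i, lam (ι i) ^ c i = 1 → c = 0) :
    ¬ (∀ α : Fin (m + 1) → 𝕜, ∃ F : MvPolynomial (Fin (m + 1)) 𝕜, F ≠ 0 ∧
        ∀ n : ℕ, eval ((A ^ n).mulVec α) F = 0) := by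
  classical
  have hl0 : ∀ i, lam i ≠ 0 := fun i => (aux_lam_ne A hA lam hlam i).1
  choose e he0 he using fun i => (aux_lam_ne A hA lam hlam (ι i)).2
  have hinj : Function.Injective fun i => lam (ι i) := by
    intro i j hij
    by_contra hne
    have := hι (Pi.single i 1 - Pi.single j 1) ?_
    · have := congrFun this i
      simp [hne] at this
    · simp only [Pi.sub_apply, zpow_sub₀ (hl0 _), Finset.prod_div_distrib]
      have hh : ∀ i : Fin m, ∏ x, lam (ι x) ^ (Pi.single (M := fun _ => ℤ) i 1 x) = lam (ι i) := by
        intro i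
        rw [Finset.prod_eq_single i]
        · simp
        · intro j _ hj; simp [hj]
        · simp
      rw [hh, hh]
      simp only at hij
      rw [hij, div_self (hl0 _)]
  let T : (Fin (m + 1) → 𝕜) →ₗ[𝕜] (Fin (m + 1) → 𝕜) := A.mulVecLin
  have hT : ∀ v, T v = A.mulVec v := fun v => rfl
  have hei : LinearIndependent 𝕜 e :=
    Module.End.eigenvectors_linearIndependent' T (fun i => lam (ι i)) hinj e
      (fun i => ⟨Module.End.mem_eigenspace_iff.2 (he i), he0 i⟩)
  obtain ⟨N, hN⟩ : ∃ N, N = Submodule.span 𝕜 (Set.range e) := ⟨_, rfl⟩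
  have hNinv : ∀ x ∈ N, T x ∈ N := by
    intro x hx
    have : N ≤ N.comap T := by
      conv_lhs => rw [hN]
      rw [Submodule.span_le]
      rintro _ ⟨i, rfl⟩
      show T (e i) ∈ N
      rw [hT, he, hN]
      exact Submodule.smul_mem _ _ (Submodule.subset_span ⟨i, rfl⟩)
    exact this hx
  have hNne : N ≠ ⊤ := by
    intro h
    have h1 := finrank_span_eq_card hei
    rw [← hN, h, finrank_top, Module.finrank_fin_fun, Fintype.card_fin] at h1
    omega
  obtain ⟨z0, hz0, l, hl⟩ := aux_L0 T N hNinv hNne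
  rw [hN] at hz0 hl
  obtain ⟨u, hu, r, hrN, hr, hur⟩ := aux_L1 T (Set.range e)
    (by rintro _ ⟨i, rfl⟩; exact ⟨_, he i⟩) l _ hl
  obtain ⟨z, hzdef⟩ : ∃ z, z = z0 + u := ⟨_, rfl⟩
  have hz : z ∉ Submodule.span 𝕜 (Set.range e) := fun h => hz0 (by
    have := sub_mem h hu
    rwa [hzdef, add_sub_cancel_right] at this)
  have hTz : T z = l • z + r := by
    rw [hzdef, ← hur, map_add, smul_add]; abel
  by_cases hr0 : r = 0
  · exfalso
    have hb : LinearIndependent 𝕜 (Fin.cons z e : Fin (m + 1) → Fin (m + 1) → 𝕜) :=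
      linearIndependent_finCons.2 ⟨hei, hz⟩
    let ν : Fin (m + 1) → 𝕜 := Fin.cons l (fun i => lam (ι i))
    have hbν : ∀ i, A.mulVec ((Fin.cons z e : Fin (m + 1) → Fin (m + 1) → 𝕜) i)
        = ν i • (Fin.cons z e : Fin (m + 1) → Fin (m + 1) → 𝕜) i := by
      intro i
      refine Fin.cases ?_ (fun i => ?_) i
      · rw [hr0, add_zero] at hTz
        exact hTz
      · simpa [ν] using he i
    obtain ⟨P, hP, hAP⟩ := aux_diag_of_basis A _ hb ν hbν
    have hchar : A.charpoly = ∏ i, (Polynomial.X - Polynomial.C (ν i)) := by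
      obtain ⟨U, rfl⟩ := (Matrix.isUnit_iff_isUnit_det _).2 hP
      rw [hAP, Matrix.charpoly_units_conj, Matrix.charpoly_diagonal]
    obtain ⟨σ, hσ⟩ := aux_perm ν lam (hchar.symm.trans hlam)
    apply hnd
    refine aux_diag_of_basis A _ (hb.comp σ.symm σ.symm.injective) lam fun i => ?_
    have := hbν (σ.symm i)
    rw [← hσ, Equiv.apply_symm_apply] at this
    exact this
  · obtain ⟨a, ha⟩ := (Submodule.mem_span_range_iff_exists_fun 𝕜).1 hrN
    have hal : ∀ i, a i * (lam (ι i) - l) = 0 := by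
      have h1 : ∑ i, (a i * (lam (ι i) - l)) • e i = 0 := by
        have h2 : T r - l • r = 0 := by rw [hr, sub_self]
        rw [← ha, map_sum, Finset.smul_sum, ← Finset.sum_sub_distrib] at h2
        rw [← h2]
        refine Finset.sum_congr rfl fun i _ => ?_
        rw [map_smul, hT, he]
        module
      exact Fintype.linearIndependent_iff.1 hei _ h1
    obtain ⟨i0, hi0⟩ : ∃ i, a i ≠ 0 := by
      by_contra h
      push Not at h
      apply hr0
      rw [← ha]
      simp [h]
    have hli : l = lam (ι i0) := by
      rcases mul_eq_zero.1 (hal i0) with h | h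
      · exact absurd h hi0
      · exact (sub_eq_zero.1 h).symm
    have hai : ∀ i, i ≠ i0 → a i = 0 := by
      intro i hi
      rcases mul_eq_zero.1 (hal i) with h | h
      · exact h
      · exact absurd (hinj ((sub_eq_zero.1 h).trans hli)) hi
    have hra : r = a i0 • e i0 := by
      rw [← ha, Finset.sum_eq_single i0]
      · intro i _ hi; rw [hai i hi, zero_smul]
      · simp
    obtain ⟨y, hydef⟩ : ∃ y, y = (a i0)⁻¹ • z := ⟨_, rfl⟩
    have hy : y ∉ Submodule.span 𝕜 (Set.range e) := by
      intro h
      apply hz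
      have := Submodule.smul_mem _ (a i0) h
      rwa [hydef, smul_smul, mul_inv_cancel₀ hi0, one_smul] at this
    have hTy : T y = l • y + e i0 := by
      rw [hydef, map_smul, hTz, hra, smul_add, smul_smul (a i0)⁻¹ (a i0), inv_mul_cancel₀ hi0,
        one_smul, smul_comm]
    let b : Fin (m + 1) → Fin (m + 1) → 𝕜 := Fin.cons y e
    have hb : LinearIndependent 𝕜 b := linearIndependent_finCons.2 ⟨hei, hy⟩
    have hlne : l ≠ 0 := hli ▸ hl0 _
    let a' : Fin (m + 1) → ℕ := Fin.cons 0 (fun i => if i = i0 then 1 else 0)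
    let ν : Fin (m + 1) → 𝕜 := Fin.cons l (fun i => lam (ι i))
    let b' : Fin (m + 1) → 𝕜 := Fin.cons 1 (fun i => if i = i0 then l⁻¹ else 1)
    have hu : IsUnit (Matrix.of b).transpose.det := by
      rw [Matrix.det_transpose]
      exact (Matrix.isUnit_iff_isUnit_det _).1 (aux_unit b hb)
    refine aux_orbit A (Matrix.of b).transpose hu (fun n t => b' t * ((n : 𝕜) ^ a' t * ν t ^ n)) ?_ ?_
    · intro n
      have hPx : ∀ x : Fin (m + 1) → 𝕜, (Matrix.of b).transpose.mulVec x
          = x 0 • y + ∑ i : Fin m, x i.succ • e i := by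
        intro x
        rw [Matrix.mulVec_transpose, Matrix.vecMul_eq_sum, Fin.sum_univ_succ]
        rfl
      rw [hPx, hPx, ← hT, map_add, map_smul, map_sum, hTy]
      have hTe : ∀ i, T (e i) = lam (ι i) • e i := he
      simp only [map_smul, hTe]
      simp only [b', a', ν, Fin.cons_zero, Fin.cons_succ]
      have hsplit : ∀ i : Fin m,
          ((if i = i0 then l⁻¹ else 1) * (((n + 1 : ℕ) : 𝕜) ^ (if i = i0 then 1 else 0) *
            lam (ι i) ^ (n + 1))) • e i
          = ((if i = i0 then l⁻¹ else 1) * ((n : 𝕜) ^ (if i = i0 then 1 else 0) *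
            lam (ι i) ^ n)) • lam (ι i) • e i + (if i = i0 then l ^ n • e i else 0) := by
        intro i
        by_cases h : i = i0
        · subst h
          simp only [if_true, ← hli, smul_smul, ← add_smul]
          congr 1
          push_cast
          field_simp
          ring
        · simp only [if_neg h, smul_smul, add_zero]
          congr 1
          ring
      rw [Finset.sum_congr rfl fun i _ => hsplit i, Finset.sum_add_distrib]
      rw [Finset.sum_ite_eq' Finset.univ i0 (fun i => l ^ n • e i)]
      simp only [Finset.mem_univ, if_true]
      generalize (∑ i : Fin m, _ : Fin (m + 1) → 𝕜) = Q
      simp only [pow_zero, one_mul, pow_succ]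
      module
    · intro G hG
      refine aux_dense a' ν b' ?_ ?_ ?_ G hG
      · intro t
        refine Fin.cases ?_ (fun i => ?_) t
        · exact hlne
        · exact hl0 _
      · intro t
        refine Fin.cases ?_ (fun i => ?_) t
        · exact one_ne_zero
        · simp only [b', Fin.cons_succ]
          split_ifs
          · exact inv_ne_zero hlne
          · exact one_ne_zero
      · intro d hd1 hd2
        rw [Fin.sum_univ_succ] at hd1
        rw [Fin.prod_univ_succ] at hd2
        simp only [a', ν, Fin.cons_zero, Fin.cons_succ] at hd1 hd2
        have hd0 : d i0.succ = 0 := by simpa using hd1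
        have hc := hι (fun i => d i.succ + Pi.single (M := fun _ => ℤ) i0 (d 0) i) (by
          simp only [zpow_add₀ (hl0 _), Finset.prod_mul_distrib]
          rw [← hd2, mul_comm]
          congr 1
          rw [Finset.prod_eq_single i0]
          · simp [hli]
          · intro j _ hj; simp [hj]
          · simp)
        have hd00 : d 0 = 0 := by
          have := congrFun hc i0
          simpa [hd0] using this
        funext t
        refine Fin.cases ?_ (fun i => ?_) t
        · exact hd00
        · have := congrFun hc i
          simpa [hd00] using this

theorem aux_diag_dense {𝕜 : Type*} [Field 𝕜] [CharZero 𝕜] {k : ℕ}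
    (A : Matrix (Fin k) (Fin k) 𝕜) (lam : Fin k → 𝕜) (hl0 : ∀ i, lam i ≠ 0)
    (P : Matrix (Fin k) (Fin k) 𝕜) (hP : IsUnit P.det) (hAP : A = P * Matrix.diagonal lam * P⁻¹)
    (hι : ∀ c : Fin k → ℤ, ∏ i, lam i ^ c i = 1 → c = 0) :
    ¬ (∀ α : Fin k → 𝕜, ∃ F : MvPolynomial (Fin k) 𝕜, F ≠ 0 ∧
        ∀ n : ℕ, eval ((A ^ n).mulVec α) F = 0) := by
  refine aux_orbit A P hP (fun n t => 1 * ((n : 𝕜) ^ 0 * lam t ^ n)) ?_ ?_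
  · intro n
    rw [hAP, Matrix.mulVec_mulVec, Matrix.mul_assoc, Matrix.nonsing_inv_mul _ hP, Matrix.mul_one,
      ← Matrix.mulVec_mulVec]
    congr 1
    funext t
    simp [Matrix.mulVec_diagonal, pow_succ']
  · intro G hG
    exact aux_dense (fun _ => 0) lam (fun _ => 1) hl0 (fun _ => one_ne_zero)
      (fun d _ h => hι d h) G hG

theorem aux_iii_i {𝕜 : Type*} [Field 𝕜] [IsAlgClosed 𝕜] [CharZero 𝕜] {k : ℕ}
    (A : Matrix (Fin k) (Fin k) 𝕜) (hA : A.det ≠ 0)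
    (lam : Fin k → 𝕜)
    (hlam : A.charpoly = ∏ i, (Polynomial.X - Polynomial.C (lam i)))
    (h : (((∃ Pm : Matrix (Fin k) (Fin k) 𝕜, IsUnit Pm.det ∧
            A = Pm * Matrix.diagonal lam * Pm⁻¹) ∧
          ∃ c : Fin k → ℤ, c ≠ 0 ∧ ∏ i, lam i ^ c i = 1) ∨
        (∀ ι : Fin (k - 1) → Fin k, Function.Injective ι →
          ∃ c : Fin (k - 1) → ℤ, c ≠ 0 ∧ ∏ i, lam (ι i) ^ c i = 1))) :
    ∃ p q : MvPolynomial (Fin k) 𝕜, q ≠ 0 ∧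
        (¬ ∃ a : 𝕜, ∀ x : Fin k → 𝕜, eval x q ≠ 0 → eval x p = a * eval x q) ∧
        ∀ x : Fin k → 𝕜,
          eval (A.mulVec x) p * eval x q = eval x p * eval (A.mulVec x) q := by
  have hl0 : ∀ i, lam i ≠ 0 := fun i => (aux_lam_ne A hA lam hlam i).1
  rcases h with ⟨⟨P, hP, hAP⟩, c, hc, hprod⟩ | h
  · have hPi : IsUnit P⁻¹ := by
      rw [Matrix.isUnit_nonsing_inv_iff]
      exact (Matrix.isUnit_iff_isUnit_det _).2 hP
    refine aux_mono A P⁻¹.row (Matrix.linearIndependent_rows_iff_isUnit.2 hPi) lam hl0 ?_ c hc hprod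
    intro i
    have e : P⁻¹ * A = Matrix.diagonal lam * P⁻¹ := by
      rw [hAP, ← Matrix.mul_assoc, ← Matrix.mul_assoc, Matrix.nonsing_inv_mul _ hP, Matrix.one_mul]
    funext j
    have e1 : Matrix.vecMul (P⁻¹.row i) A j = (P⁻¹ * A) i j := rfl
    rw [e1, e, Matrix.diagonal_mul]
    rfl
  · rcases k with _ | m
    · obtain ⟨c, hc, _⟩ := h (fun i => i) (fun i j h => h)
      exact absurd (funext fun i => Fin.elim0 i) hc
    · change ∀ ι : Fin m → Fin (m + 1), Function.Injective ι →
          ∃ c : Fin m → ℤ, c ≠ 0 ∧ ∏ i, lam (ι i) ^ c i = 1 at h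
      by_cases hS : Module.finrank 𝕜 (Submodule.span 𝕜
          {v : Fin (m + 1) → 𝕜 | ∃ μ : 𝕜, Matrix.vecMul v A = μ • v}) + 1 < m + 1
      · exact aux_defect A hA hS
      · obtain ⟨f, hf1, _, hf3⟩ := Submodule.exists_fun_fin_finrank_span_eq 𝕜
          {v : Fin (m + 1) → 𝕜 | ∃ μ : 𝕜, Matrix.vecMul v A = μ • v}
        have hle : m ≤ Module.finrank 𝕜 (Submodule.span 𝕜
          {v : Fin (m + 1) → 𝕜 | ∃ μ : 𝕜, Matrix.vecMul v A = μ • v}) := by omega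
        have hw := hf3.comp (Fin.castLE hle) (Fin.castLE_injective hle)
        choose ν hν using fun i : Fin m => hf1 (Fin.castLE hle i)
        obtain ⟨ι, hι, hιν⟩ := aux_eig A lam hlam _ hw ν hν
        obtain ⟨c, hc, hprod⟩ := h ι hι
        exact aux_mono A _ hw ν (fun i => hιν i ▸ hl0 _) hν c hc (by simpa only [hιν] using hprod)

theorem aux_ii_iii {𝕜 : Type*} [Field 𝕜] [IsAlgClosed 𝕜] [CharZero 𝕜] {k : ℕ}
    (A : Matrix (Fin k) (Fin k) 𝕜) (hA : A.det ≠ 0)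
    (lam : Fin k → 𝕜)
    (hlam : A.charpoly = ∏ i, (Polynomial.X - Polynomial.C (lam i)))
    (h : (∀ α : Fin k → 𝕜, ∃ F : MvPolynomial (Fin k) 𝕜, F ≠ 0 ∧
        ∀ n : ℕ, eval ((A ^ n).mulVec α) F = 0)) :
    (((∃ Pm : Matrix (Fin k) (Fin k) 𝕜, IsUnit Pm.det ∧
            A = Pm * Matrix.diagonal lam * Pm⁻¹) ∧
          ∃ c : Fin k → ℤ, c ≠ 0 ∧ ∏ i, lam i ^ c i = 1) ∨
        (∀ ι : Fin (k - 1) → Fin k, Function.Injective ι →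
          ∃ c : Fin (k - 1) → ℤ, c ≠ 0 ∧ ∏ i, lam (ι i) ^ c i = 1)) := by
  have hl0 : ∀ i, lam i ≠ 0 := fun i => (aux_lam_ne A hA lam hlam i).1
  by_cases hd : ∃ Pm : Matrix (Fin k) (Fin k) 𝕜, IsUnit Pm.det ∧
            A = Pm * Matrix.diagonal lam * Pm⁻¹
  · left
    refine ⟨hd, ?_⟩
    obtain ⟨P, hP, hAP⟩ := hd
    by_contra hc
    refine aux_diag_dense A lam hl0 P hP hAP ?_ h
    intro c hc1
    by_contra hc0
    exact hc ⟨c, hc0, hc1⟩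
  · right
    rcases k with _ | m
    · exact absurd ⟨1, by simp, Subsingleton.elim _ _⟩ hd
    · intro ι _
      by_contra hc
      refine aux_nondiag A hA lam hlam hd ι ?_ h
      intro c hc1
      by_contra hc0
      exact hc ⟨c, hc0, hc1⟩

/-- Theorem on 𝔾_a^k: for an invertible matrix `A` over an
algebraically closed field of characteristic 0 with eigenvalue list `lam`
(`charpoly A = ∏ (X - lam i)`), the following are equivalent:
(i) `Φ(x) = A·x` preserves a non-constant rational function `p/q`;
(ii) no point of `𝕜^k` has Zariski dense orbit under `Φ`;
(iii) either `A` is diagonalizable with multiplicatively dependent eigenvalues, or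
`A` has at most `k−2` multiplicatively independent eigenvalues (every choice of
`k−1` of the eigenvalues is multiplicatively dependent). -/
theorem stmt16 {𝕜 : Type*} [Field 𝕜] [IsAlgClosed 𝕜] [CharZero 𝕜] {k : ℕ}
    (A : Matrix (Fin k) (Fin k) 𝕜) (hA : A.det ≠ 0)
    (lam : Fin k → 𝕜)
    (hlam : A.charpoly = ∏ i, (Polynomial.X - Polynomial.C (lam i))) :
    ((∃ p q : MvPolynomial (Fin k) 𝕜, q ≠ 0 ∧
        (¬ ∃ a : 𝕜, ∀ x : Fin k → 𝕜, eval x q ≠ 0 → eval x p = a * eval x q) ∧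
        ∀ x : Fin k → 𝕜,
          eval (A.mulVec x) p * eval x q = eval x p * eval (A.mulVec x) q) ↔
      (∀ α : Fin k → 𝕜, ∃ F : MvPolynomial (Fin k) 𝕜, F ≠ 0 ∧
        ∀ n : ℕ, eval ((A ^ n).mulVec α) F = 0)) ∧
    ((∀ α : Fin k → 𝕜, ∃ F : MvPolynomial (Fin k) 𝕜, F ≠ 0 ∧
        ∀ n : ℕ, eval ((A ^ n).mulVec α) F = 0) ↔
      (((∃ Pm : Matrix (Fin k) (Fin k) 𝕜, IsUnit Pm.det ∧
            A = Pm * Matrix.diagonal lam * Pm⁻¹) ∧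
          ∃ c : Fin k → ℤ, c ≠ 0 ∧ ∏ i, lam i ^ c i = 1) ∨
        (∀ ι : Fin (k - 1) → Fin k, Function.Injective ι →
          ∃ c : Fin (k - 1) → ℤ, c ≠ 0 ∧ ∏ i, lam (ι i) ^ c i = 1))) := by
  exact ⟨⟨aux_i_ii A hA, fun h => aux_iii_i A hA lam hlam (aux_ii_iii A hA lam hlam h)⟩,
    ⟨aux_ii_iii A hA lam hlam, fun h => aux_i_ii A hA (aux_iii_i A hA lam hlam h)⟩⟩
end
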